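/- arXiv:1904.07281 — 6 statements merged into one kernel-verified Lean document; each statement's English description precedes it below -/
import Mathlib

section
/- Let k be an algebraically closed field of characteristic zero. Then the three k-algebras k⟨x,y⟩/(xy−yx) (the commutative polynomial ring in two variables), k⟨x,y⟩/(xy−yx−1) (the first Weyl algebra), and k⟨x,y⟩/(xy−yx−x) are pairwise not Morita equivalent. -/
universe u

/-- The free associative algebra `k⟨x,y⟩` on two generators. -/
abbrev FA (k : Type u) [Field k] : Type u := FreeAlgebra k (Fin 2)

/-- The quotient of the free algebra `k⟨x,y⟩` by the two-sided ideal generated by `f`. -/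
abbrev AQuot (k : Type u) [Field k] (f : FA k) : Type u :=
  RingQuot (fun a b : FA k => a = f ∧ b = 0)

/-- Two rings are Morita equivalent if their module categories are equivalent. -/
def IsMorita (A B : Type u) [Ring A] [Ring B] : Prop :=
  Nonempty (ModuleCat.{u} A ≌ ModuleCat.{u} B)

/-! ### Faithfulness of modules over the Weyl algebra -/

section Weyl

open Polynomial

theorem commutator_aeval {k R : Type*} [Field k] [Ring R] [Algebra k R] {a b : R}
    (h : a * b - b * a = 1) (p : k[X]) :
    a * aeval b p - aeval b p * a = aeval b (derivative p) := by
  induction p using Polynomial.induction_on with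
  | C c => simp [Algebra.commutes]
  | add p q hp hq =>
    simp only [map_add, ← hp, ← hq]
    noncomm_ring
  | monomial n c ih =>
    have hX : (C c * X ^ (n + 1) : k[X]) = C c * X ^ n * X := by ring
    have hab : a * b = 1 + b * a := by rw [← h]; abel
    rw [hX]
    generalize (C c * X ^ n : k[X]) = q at ih
    rw [derivative_mul, derivative_X, mul_one, map_add, map_mul, map_mul, aeval_X, ← ih]
    generalize aeval b q = d
    simp only [sub_mul, mul_assoc, hab, mul_add, mul_one]
    abel

variable {k R : Type*} [Field k] [Ring R] [Algebra k R] {x y : R}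

theorem commutator_eval₂ (h : x * y - y * x = 1) (P : k[X][X]) :
    x * P.eval₂ (aeval x : k[X] →ₐ[k] R).toRingHom y -
      P.eval₂ (aeval x : k[X] →ₐ[k] R).toRingHom y * x =
      (derivative P).eval₂ (aeval x : k[X] →ₐ[k] R).toRingHom y := by
  induction P using Polynomial.induction_on' with
  | add p q hp hq =>
    simp only [map_add, eval₂_add, ← hp, ← hq]
    noncomm_ring
  | monomial n p =>
    have hc : x * aeval x p = aeval x p * x := by
      simpa using congrArg (aeval x) (mul_comm (X : k[X]) p)
    have hy := commutator_aeval (k := k) h (X ^ n)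
    simp only [derivative_X_pow, map_mul, map_pow, aeval_X, map_natCast] at hy
    simp only [derivative_monomial, eval₂_monomial, AlgHom.toRingHom_eq_coe, RingHom.coe_coe,
      map_mul, map_natCast]
    rw [mul_assoc _ (n : R), ← hy, mul_sub, ← mul_assoc, ← mul_assoc, ← mul_assoc, hc]

theorem exists_eval₂_eq (h : x * y - y * x = 1) (hgen : Algebra.adjoin k {x, y} = ⊤) (r : R) :
    ∃ P : k[X][X], P.eval₂ (aeval x : k[X] →ₐ[k] R).toRingHom y = r := by
  have hr : r ∈ Algebra.adjoin k {x, y} := hgen ▸ Algebra.mem_top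
  suffices H : ∀ P : k[X][X], ∃ Q : k[X][X], Q.eval₂ (aeval x : k[X] →ₐ[k] R).toRingHom y =
      r * P.eval₂ (aeval x : k[X] →ₐ[k] R).toRingHom y by
    simpa using H 1
  induction hr using Algebra.adjoin_induction with
  | mem s hs =>
    intro P
    induction P using Polynomial.induction_on' with
    | add p q hp hq =>
      obtain ⟨p', hp⟩ := hp
      obtain ⟨q', hq⟩ := hq
      exact ⟨p' + q', by rw [eval₂_add, eval₂_add, hp, hq, mul_add]⟩
    | monomial n p =>
      rcases hs with rfl | hs
      · exact ⟨monomial n (X * p), by simp [eval₂_monomial, mul_assoc]⟩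
      · obtain rfl : s = y := hs
        refine ⟨monomial (n + 1) p - monomial n (derivative p), ?_⟩
        have hx := commutator_aeval (a := -s) (b := x)
          (by rw [← h]; noncomm_ring) p
        simp only [eval₂_sub, eval₂_monomial, AlgHom.toRingHom_eq_coe, RingHom.coe_coe, ← hx,
          pow_succ']
        noncomm_ring
  | algebraMap c =>
    intro P
    refine ⟨C (C c) * P, ?_⟩
    induction P using Polynomial.induction_on' with
    | add p q hp hq => rw [mul_add, eval₂_add, eval₂_add, hp, hq, mul_add]
    | monomial n p => simp [C_mul_monomial, eval₂_monomial, mul_assoc]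
  | add s t _ _ hs ht =>
    intro P
    obtain ⟨p, hp⟩ := hs P
    obtain ⟨q, hq⟩ := ht P
    exact ⟨p + q, by rw [eval₂_add, hp, hq, add_mul]⟩
  | mul s t _ _ hs ht =>
    intro P
    obtain ⟨p, hp⟩ := ht P
    obtain ⟨q, hq⟩ := hs p
    exact ⟨q, by rw [hq, hp, mul_assoc]⟩

variable [CharZero k] {M : Type*} [AddCommGroup M] [Module R M]

theorem eq_zero_of_aeval_smul_eq_zero [Nontrivial M] (h : x * y - y * x = 1) (p : k[X])
    (hp : ∀ m : M, aeval x p • m = 0) : p = 0 := by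
  induction hn : p.natDegree using Nat.strong_induction_on generalizing p with
  | _ n ih =>
    by_cases hn0 : n = 0
    · obtain ⟨c, rfl⟩ := natDegree_eq_zero.mp (hn.trans hn0)
      obtain ⟨m, hm⟩ := exists_ne (0 : M)
      by_contra hc
      have hc0 : c ≠ 0 := by rintro rfl; simp at hc
      apply hm
      have := congrArg (fun t ↦ algebraMap k R c⁻¹ • t) (hp m)
      simpa [← mul_smul, ← map_mul, hc0] using this
    · have hd : derivative p = 0 := by
        refine ih _ (hn ▸ natDegree_derivative_lt (hn ▸ hn0)) _ (fun m ↦ ?_) rfl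
        rw [← commutator_aeval (a := -y) (b := x) (by rw [← h]; noncomm_ring) p, sub_smul,
          mul_smul, mul_smul, hp, hp, smul_zero, sub_zero]
      exact absurd (hn.symm.trans (derivative_eq_zero.mp hd)) hn0

theorem eq_zero_of_eval₂_smul_eq_zero [Nontrivial M] (h : x * y - y * x = 1) (P : k[X][X])
    (hP : ∀ m : M, P.eval₂ (aeval x : k[X] →ₐ[k] R).toRingHom y • m = 0) : P = 0 := by
  induction hn : P.natDegree using Nat.strong_induction_on generalizing P with
  | _ n ih =>
    by_cases hn0 : n = 0
    · obtain ⟨p, rfl⟩ := natDegree_eq_zero.mp (hn.trans hn0)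
      rw [eq_zero_of_aeval_smul_eq_zero (M := M) h p (by simpa using hP), C_0]
    · have hd : derivative P = 0 := by
        refine ih _ (hn ▸ natDegree_derivative_lt (hn ▸ hn0)) _ (fun m ↦ ?_) rfl
        rw [← commutator_eval₂ h P, sub_smul, mul_smul, mul_smul, hP, hP, smul_zero, sub_zero]
      exact absurd (hn.symm.trans (derivative_eq_zero.mp hd)) hn0

/-- A nonzero element of an algebra generated by `x, y` with `xy - yx = 1` acts nontrivially on
every nonzero module. -/
theorem exists_smul_ne_zero_of_weyl [Nontrivial M] (h : x * y - y * x = 1)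
    (hgen : Algebra.adjoin k {x, y} = ⊤) {r : R} (hr : r ≠ 0) : ∃ m : M, r • m ≠ 0 := by
  obtain ⟨P, rfl⟩ := exists_eval₂_eq h hgen r
  by_contra! hP
  exact hr (by rw [eq_zero_of_eval₂_smul_eq_zero h P hP, eval₂_zero])

end Weyl

/-! ### Categorical invariants -/

section Invariants

open CategoryTheory

variable {A B : Type u} [Ring A] [Ring B]

theorem IsMorita.symm (h : IsMorita A B) : IsMorita B A :=
  h.map fun e ↦ e.symm

/-- A ring whose nonzero modules are all faithful is not Morita equivalent to a ring having
a nonzero module killed by a nonzero element. -/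
theorem not_isMorita_of_faithful
    (hB : ∀ (M : ModuleCat.{u} B) [Nontrivial M] (r : B), r ≠ 0 → ∃ m : M, r • m ≠ 0)
    (M : ModuleCat.{u} A) [Nontrivial M] {a : A} (ha : a ≠ 0) (haM : ∀ m : M, a • m = 0) :
    ¬ IsMorita A B := by
  rintro ⟨e⟩
  let P : ModuleCat.{u} A := ModuleCat.of A A
  have : Projective P := (IsProjective.iff_projective A).mp inferInstance
  let f : P ⟶ P := ModuleCat.ofHom (LinearMap.toSpanSingleton A A a)
  have hf : f ≠ 0 := fun h ↦ ha <| by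
    have h1 : (1 : A) • a = 0 := congrArg (fun g : P ⟶ P ↦ g.hom (1 : A)) h
    rwa [one_smul] at h1
  have hfg (g : P ⟶ M) : f ≫ g = 0 := by
    ext
    have := haM (g.hom (1 : A))
    rw [← map_smul] at this
    simpa [f, P] using this
  have : Nontrivial (e.functor.obj M) := by
    rw [← not_subsingleton_iff_nontrivial, ← ModuleCat.isZero_iff_subsingleton]
    intro hz
    have := ModuleCat.isZero_iff_subsingleton.mp
      (Limits.IsZero.of_full_of_faithful_of_isZero e.functor M hz)
    exact not_subsingleton M this
  have hPB : Projective (e.functor.obj P) := (e.map_projective_iff P).mpr inferInstance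
  have : Module.Projective B (e.functor.obj P) :=
    ModuleCat.projective_of_module_projective _
  obtain ⟨s, hs⟩ := Module.Projective.out (R := B) (P := e.functor.obj P)
  have hf' : e.functor.map f ≠ 0 := fun h ↦ hf ((e.functor.map_eq_zero_iff).mp h)
  obtain ⟨q, hq⟩ : ∃ q, (e.functor.map f).hom q ≠ 0 := by
    by_contra! h
    exact hf' (by ext q; exact h q)
  have hsq : s ((e.functor.map f).hom q) ≠ 0 := fun h ↦ hq <| by
    rw [← hs ((e.functor.map f).hom q), h, map_zero]
  obtain ⟨i, hi⟩ := Finsupp.ne_iff.mp hsq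
  obtain ⟨m, hm⟩ := hB (e.functor.obj M) _ hi
  let g : e.functor.obj P ⟶ e.functor.obj M :=
    ModuleCat.ofHom (LinearMap.toSpanSingleton B _ m ∘ₗ Finsupp.lapply i ∘ₗ s)
  obtain ⟨g', hg'⟩ := e.functor.map_surjective g
  have h0 : e.functor.map f ≫ g = 0 := by
    rw [← hg', ← e.functor.map_comp, hfg, e.functor.map_zero]
  exact hm (by simpa [g] using congrArg (fun t ↦ t.hom q) h0)

/-- Over a commutative ring, a module with a nonzero submodule and a simple quotient admitting
no nonzero map to this submodule has an endomorphism which is neither zero nor injective. -/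
theorem exists_endomorphism_of_commute (hA : ∀ a b : A, a * b = b * a) {S E T : ModuleCat.{u} A}
    (i : S ⟶ E) [Mono i] (p : E ⟶ T) [Epi p] [Nontrivial S] [Simple T]
    (hTS : ∀ g : T ⟶ S, g = 0) : ∃ h : E ⟶ E, h ≠ 0 ∧ ¬ IsIso h := by
  have : IsSimpleModule A T := (simple_iff_isSimpleModule' T).mp inferInstance
  have : Nontrivial T := IsSimpleModule.nontrivial A T
  obtain ⟨s, hs⟩ := exists_ne (0 : S)
  obtain ⟨t, ht⟩ := exists_ne (0 : T)
  have hsurj := IsSimpleModule.toSpanSingleton_surjective A ht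
  obtain ⟨a, hat, has⟩ : ∃ a : A, a • t = 0 ∧ a • s ≠ 0 := by
    by_contra! hker
    let g : T →ₗ[A] S := (Submodule.liftQ _ (LinearMap.toSpanSingleton A S s)
        fun a ha ↦ LinearMap.mem_ker.mpr (hker a ha)) ∘ₗ
      ((LinearMap.toSpanSingleton A T t).quotKerEquivOfSurjective hsurj).symm.toLinearMap
    have hgt : g t = s := by
      have h1 : ((LinearMap.toSpanSingleton A T t).quotKerEquivOfSurjective hsurj).symm t =
          Submodule.Quotient.mk 1 := by
        rw [LinearEquiv.symm_apply_eq]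
        simp [LinearMap.quotKerEquivOfSurjective]
      simp only [g, LinearMap.comp_apply, LinearEquiv.coe_coe, h1]
      simp
    refine hs ?_
    rw [← hgt]
    exact congrArg (fun g : T ⟶ S ↦ g.hom t) (hTS (ModuleCat.ofHom g))
  have haT (u : T) : a • u = 0 := by
    obtain ⟨b, rfl⟩ := hsurj u
    simp only [LinearMap.toSpanSingleton_apply]
    rw [← mul_smul, hA, mul_smul, hat, smul_zero]
  let h : E →ₗ[A] E :=
    { toFun := fun v ↦ a • v
      map_add' := smul_add a
      map_smul' := fun b v ↦ by simp [← mul_smul, hA a b] }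
  refine ⟨ModuleCat.ofHom h, fun h0 ↦ has ?_, fun hiso ↦ ht ?_⟩
  · apply (ModuleCat.mono_iff_injective i).mp inferInstance
    have : a • i.hom s = 0 := congrArg (fun g : E ⟶ E ↦ g.hom (i.hom s)) h0
    rw [map_zero, map_smul]
    exact this
  · obtain ⟨v, rfl⟩ := (ModuleCat.epi_iff_surjective p).mp inferInstance t
    obtain ⟨w, rfl⟩ := (ModuleCat.epi_iff_surjective (ModuleCat.ofHom h)).mp inferInstance v
    have : p.hom (a • w) = 0 := by rw [map_smul, haT]
    exact this

/-- A commutative ring is not Morita equivalent to a ring having a module all of whose nonzero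
endomorphisms are invertible, with a nonzero submodule and a simple quotient admitting no nonzero
map to this submodule. -/
theorem not_isMorita_of_commute (hA : ∀ a b : A, a * b = b * a) {S E T : ModuleCat.{u} B}
    (i : S ⟶ E) [Mono i] (p : E ⟶ T) [Epi p] [Simple S] [Simple T]
    (hTS : ∀ g : T ⟶ S, g = 0) (hE : ∀ h : E ⟶ E, h ≠ 0 → IsIso h) : ¬ IsMorita A B := by
  rintro ⟨e⟩
  let G := e.inverse
  have : Simple (G.obj S) := simple_obj G S
  have : Simple (G.obj T) := simple_obj G T
  have : IsSimpleModule A (G.obj S) := (simple_iff_isSimpleModule' _).mp inferInstance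
  have : Nontrivial (G.obj S) := IsSimpleModule.nontrivial A _
  obtain ⟨h, h0, hiso⟩ := exists_endomorphism_of_commute hA (G.map i) (G.map p) (fun g ↦ by
    obtain ⟨g, rfl⟩ := G.map_surjective g
    rw [hTS g, G.map_zero])
  obtain ⟨h, rfl⟩ := G.map_surjective h
  have : IsIso h := hE h fun hh ↦ h0 (by rw [hh, G.map_zero])
  exact hiso inferInstance

end Invariants

/-! ### Presentations and representations -/

section Presentation

open CategoryTheory

variable {k : Type u} [Field k]

namespace AQuot

variable (f : FA k)

/-- The images of the two generators in the quotient of the free algebra. -/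
def gen (j : Fin 2) : AQuot k f := RingQuot.mkAlgHom k _ (FreeAlgebra.ι k j)

theorem mk_eq_zero : RingQuot.mkAlgHom k (fun a b : FA k ↦ a = f ∧ b = 0) f = 0 := by
  rw [← map_zero (RingQuot.mkAlgHom k (fun a b : FA k ↦ a = f ∧ b = 0))]
  exact RingQuot.mkAlgHom_rel k ⟨rfl, rfl⟩

theorem adjoin_gen : Algebra.adjoin k {gen f 0, gen f 1} = ⊤ := by
  have h := congrArg (Subalgebra.map (RingQuot.mkAlgHom k (fun a b : FA k ↦ a = f ∧ b = 0)))
    (FreeAlgebra.adjoin_range_ι k (Fin 2))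
  rw [AlgHom.map_adjoin, Algebra.map_top, (AlgHom.range_eq_top _).mpr
    (RingQuot.mkAlgHom_surjective k _), ← Set.range_comp] at h
  rw [← h]
  congr 1
  ext a
  simp [gen, Fin.exists_fin_two, eq_comm]

variable {f} {V : Type u} [AddCommGroup V] [Module k V]

theorem exists_algHom {R : Type*} [Ring R] [Algebra k R] (X : Fin 2 → R)
    (h : FreeAlgebra.lift k X f = 0) :
    ∃ ρ : AQuot k f →ₐ[k] R, ∀ j, ρ (gen f j) = X j := by
  refine ⟨RingQuot.liftAlgHom k ⟨FreeAlgebra.lift k X, ?_⟩, fun j ↦ ?_⟩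
  · rintro _ _ ⟨rfl, rfl⟩
    rw [h, map_zero]
  · simp [gen]


/-- The module over a quotient of the free algebra attached to a representation. -/
noncomputable def rep (ρ : AQuot k f →ₐ[k] Module.End k V) : ModuleCat.{u} (AQuot k f) :=
  (ModuleCat.restrictScalars ρ.toRingHom).obj (ModuleCat.of (Module.End k V) V)

theorem nontrivial_rep [Nontrivial V] (ρ : AQuot k f →ₐ[k] Module.End k V) :
    Nontrivial (rep ρ) :=
  inferInstanceAs (Nontrivial V)

theorem intertwines_of_gen {W : Type u} [AddCommGroup W] [Module k W]
    {ρ : AQuot k f →ₐ[k] Module.End k V} {σ : AQuot k f →ₐ[k] Module.End k W} (g : V →ₗ[k] W)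
    (h : ∀ j v, g (ρ (gen f j) v) = σ (gen f j) (g v)) (r : AQuot k f) (v : V) :
    g (ρ r v) = σ r (g v) := by
  have hr : r ∈ Algebra.adjoin k {gen f 0, gen f 1} := adjoin_gen f ▸ Algebra.mem_top
  induction hr using Algebra.adjoin_induction generalizing v with
  | mem s hs =>
    rcases hs with rfl | rfl
    · exact h 0 v
    · exact h 1 v
  | algebraMap c => simp [AlgHom.commutes]
  | add s t _ _ hs ht => simp [hs, ht]
  | mul s t _ _ hs ht => simp [hs, ht]

/-- A linear map intertwining the actions of the generators is a morphism of modules. -/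
noncomputable def repHom {W : Type u} [AddCommGroup W] [Module k W]
    {ρ : AQuot k f →ₐ[k] Module.End k V} {σ : AQuot k f →ₐ[k] Module.End k W} (g : V →ₗ[k] W)
    (h : ∀ j v, g (ρ (gen f j) v) = σ (gen f j) (g v)) : rep ρ ⟶ rep σ :=
  ModuleCat.ofHom (X := rep ρ) (Y := rep σ)
    { toFun := g
      map_add' := g.map_add
      map_smul' := intertwines_of_gen g h }

theorem map_rep {W : Type u} [AddCommGroup W] [Module k W]
    {ρ : AQuot k f →ₐ[k] Module.End k V} {σ : AQuot k f →ₐ[k] Module.End k W}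
    (g : rep ρ ⟶ rep σ) : ∃ g' : V →ₗ[k] W, (∀ v : V, g.hom v = g' v) ∧
      ∀ r v, g' (ρ r v) = σ r (g' v) :=
  ⟨{ toFun := g.hom
     map_add' := g.hom.map_add
     map_smul' := fun c v ↦ by
      have h : g.hom (ρ (algebraMap k _ c) v) = σ (algebraMap k _ c) (g.hom v) :=
        g.hom.map_smul (algebraMap k _ c) v
      rw [AlgHom.commutes, AlgHom.commutes] at h
      exact h }, fun _ ↦ rfl, g.hom.map_smul⟩

theorem simple_rep (ρ : AQuot k f →ₐ[k] Module.End k k) : Simple (rep ρ) := by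
  rw [simple_iff_isSimpleModule', isSimpleModule_iff_toSpanSingleton_surjective]
  refine ⟨nontrivial_rep ρ, fun (v : k) (hv : v ≠ 0) (w : k) ↦ ⟨algebraMap k _ (w / v), ?_⟩⟩
  have h : ρ (algebraMap k _ (w / v)) v = w := by
    rw [AlgHom.commutes]
    simp [hv]
  exact h

theorem gen_mul_gen_weyl {f : FA k} (hf : f = FreeAlgebra.ι k 0 * FreeAlgebra.ι k 1 -
    FreeAlgebra.ι k 1 * FreeAlgebra.ι k 0 - 1) :
    gen f 0 * gen f 1 - gen f 1 * gen f 0 = 1 := by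
  have h := mk_eq_zero f
  conv at h => enter [1, 2]; rw [hf]
  rw [map_sub, map_sub, map_mul, map_mul, map_one] at h
  exact sub_eq_zero.mp h

theorem mul_comm_of_gen (h : gen f 0 * gen f 1 = gen f 1 * gen f 0) (a b : AQuot k f) :
    a * b = b * a := by
  have key (c : AQuot k f) (hc : ∀ j, Commute c (gen f j)) (d : AQuot k f) : Commute c d := by
    have hd : d ∈ Algebra.adjoin k {gen f 0, gen f 1} := adjoin_gen f ▸ Algebra.mem_top
    refine Algebra.commute_of_mem_adjoin_of_forall_mem_commute hd ?_
    rintro _ (rfl | rfl)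
    exacts [hc 0, hc 1]
  refine key a (fun j ↦ (key _ (fun i ↦ ?_) a).symm) b
  fin_cases i <;> fin_cases j
  exacts [rfl, h.symm, h, rfl]

/-- An algebra on two generators with a character killing the first generator, which is nonzero,
is not Morita equivalent to the Weyl algebra. -/
theorem not_isMorita_weyl [CharZero k] (χ : AQuot k f →ₐ[k] Module.End k k)
    (hχ : χ (gen f 0) = 0) (h0 : gen f 0 ≠ 0) :
    ¬ IsMorita (AQuot k f) (AQuot k (FreeAlgebra.ι k (0 : Fin 2) * FreeAlgebra.ι k (1 : Fin 2) -
      FreeAlgebra.ι k (1 : Fin 2) * FreeAlgebra.ι k (0 : Fin 2) - 1)) := by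
  have := nontrivial_rep χ
  refine not_isMorita_of_faithful (fun M _ r hr ↦ exists_smul_ne_zero_of_weyl
    (gen_mul_gen_weyl rfl) (adjoin_gen _) hr) (rep χ) h0 fun (m : k) ↦ ?_
  have h : χ (gen f 0) m = 0 := by rw [hχ]; rfl
  exact h

/-- A commutative ring is not Morita equivalent to an algebra on two generators `x, y` having
representations in which `x` is the elementary nilpotent matrix and `y = diag(0, 1)`, as well as
the corresponding sub and quotient representations. -/
theorem not_isMorita_of_nonsplit {A : Type u} [Ring A] (hA : ∀ a b : A, a * b = b * a)
    (σ τ : AQuot k f →ₐ[k] Module.End k k) (ε : AQuot k f →ₐ[k] Module.End k (k × k))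
    (hσ : ∀ j, σ (gen f j) = 0) (hτ₀ : τ (gen f 0) = 0) (hτ₁ : τ (gen f 1) = 1)
    (hε₀ : ∀ v, ε (gen f 0) v = (v.2, 0)) (hε₁ : ∀ v, ε (gen f 1) v = (0, v.2)) :
    ¬ IsMorita A (AQuot k f) := by
  have := simple_rep σ
  have := simple_rep τ
  let i : rep σ ⟶ rep ε := repHom (LinearMap.inl k k k) fun j v ↦ by
    rw [hσ]
    fin_cases j <;> simp [hε₀, hε₁]
  let p : rep ε ⟶ rep τ := repHom (LinearMap.snd k k k) fun j v ↦ by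
    fin_cases j <;> simp [hε₀, hε₁, hτ₀, hτ₁]
  have : Mono i := (ModuleCat.mono_iff_injective i).mpr 
    (LinearMap.inl_injective (R := k) (M := k) (M₂ := k))
  have : Epi p := (ModuleCat.epi_iff_surjective p).mpr 
    (LinearMap.snd_surjective (R := k) (M := k) (M₂ := k))
  refine not_isMorita_of_commute hA i p (fun g ↦ ?_) fun h h0 ↦ ?_
  · obtain ⟨g', hg, hg'⟩ := map_rep g
    ext v
    have := hg' (gen f 1) v
    rw [hτ₁, hσ] at this
    exact (hg v).trans this
  · obtain ⟨g, hg, hgε⟩ := map_rep h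
    have e₁ := hgε (gen f 1) (0, 1)
    have e₀ := hgε (gen f 0) (0, 1)
    simp only [hε₁, hε₀] at e₀ e₁
    set c := (g (0, 1)).2 with hc
    have hgc (v : k × k) : g v = c • v := by
      have hv : v = v.1 • ((1, 0) : k × k) + v.2 • ((0, 1) : k × k) := by simp
      rw [hv, map_add, map_smul, map_smul, e₀, e₁]
      ext <;> simp [mul_comm]
    have hc0 : c ≠ 0 := fun hz ↦ h0 <| by
      have hv (v : k × k) : g v = 0 := by rw [hgc, hz, zero_smul]
      ext v
      exact (hg v).trans (hv v)
    refine (ConcreteCategory.isIso_iff_bijective h).mpr ?_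
    have hbij : Function.Bijective g := by
      rw [funext hgc]
      exact (LinearEquiv.smulOfNeZero k (k × k) c hc0).bijective
    exact (funext hg : (h.hom : rep ε → rep ε) = g) ▸ hbij

end AQuot

end Presentation

/-- Over an algebraically closed field of characteristic zero, the algebras
`k⟨x,y⟩/(xy−yx)`, `k⟨x,y⟩/(xy−yx−1)` and `k⟨x,y⟩/(xy−yx−x)` are pairwise not
Morita equivalent. -/
theorem statement0 (k : Type u) [Field k] [IsAlgClosed k] [CharZero k] :
    (¬ IsMorita
        (AQuot k (FreeAlgebra.ι k (0 : Fin 2) * FreeAlgebra.ι k (1 : Fin 2) -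
          FreeAlgebra.ι k (1 : Fin 2) * FreeAlgebra.ι k (0 : Fin 2)))
        (AQuot k (FreeAlgebra.ι k (0 : Fin 2) * FreeAlgebra.ι k (1 : Fin 2) -
          FreeAlgebra.ι k (1 : Fin 2) * FreeAlgebra.ι k (0 : Fin 2) - 1))) ∧
    (¬ IsMorita
        (AQuot k (FreeAlgebra.ι k (0 : Fin 2) * FreeAlgebra.ι k (1 : Fin 2) -
          FreeAlgebra.ι k (1 : Fin 2) * FreeAlgebra.ι k (0 : Fin 2)))
        (AQuot k (FreeAlgebra.ι k (0 : Fin 2) * FreeAlgebra.ι k (1 : Fin 2) -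
          FreeAlgebra.ι k (1 : Fin 2) * FreeAlgebra.ι k (0 : Fin 2) -
          FreeAlgebra.ι k (0 : Fin 2)))) ∧
    (¬ IsMorita
        (AQuot k (FreeAlgebra.ι k (0 : Fin 2) * FreeAlgebra.ι k (1 : Fin 2) -
          FreeAlgebra.ι k (1 : Fin 2) * FreeAlgebra.ι k (0 : Fin 2) - 1))
        (AQuot k (FreeAlgebra.ι k (0 : Fin 2) * FreeAlgebra.ι k (1 : Fin 2) -
          FreeAlgebra.ι k (1 : Fin 2) * FreeAlgebra.ι k (0 : Fin 2) -
          FreeAlgebra.ι k (0 : Fin 2)))) := by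
  let f₁ : FA k := FreeAlgebra.ι k 0 * FreeAlgebra.ι k 1 - FreeAlgebra.ι k 1 * FreeAlgebra.ι k 0
  let f₃ : FA k := FreeAlgebra.ι k 0 * FreeAlgebra.ι k 1 - FreeAlgebra.ι k 1 * FreeAlgebra.ι k 0 -
    FreeAlgebra.ι k 0
  obtain ⟨χ, hχ⟩ := AQuot.exists_algHom (f := f₁) (R := Module.End k k) 0 (by simp [f₁])
  obtain ⟨σ, hσ⟩ := AQuot.exists_algHom (f := f₃) (R := Module.End k k) 0 (by simp [f₃])
  obtain ⟨τ, hτ⟩ := AQuot.exists_algHom (f := f₃) (R := Module.End k k) ![0, 1] (by simp [f₃])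
  obtain ⟨ε, hε⟩ := AQuot.exists_algHom (f := f₃) (R := Module.End k (k × k))
    ![LinearMap.inl k k k ∘ₗ LinearMap.snd k k k, LinearMap.inr k k k ∘ₗ LinearMap.snd k k k]
    (by ext <;> simp [f₃])
  have hx₁ : AQuot.gen f₁ 0 ≠ 0 := by
    obtain ⟨ψ, hψ⟩ := AQuot.exists_algHom (f := f₁) (R := k) ![1, 0] (by simp [f₁])
    intro h
    simpa [h] using hψ 0
  have hε₀ (v : k × k) : ε (AQuot.gen f₃ 0) v = (v.2, 0) := by rw [hε]; rfl
  have hε₁ (v : k × k) : ε (AQuot.gen f₃ 1) v = (0, v.2) := by rw [hε]; rfl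
  have hx₃ : AQuot.gen f₃ 0 ≠ 0 := fun h ↦ by
    have h1 := hε₀ (0, 1)
    rw [h, map_zero] at h1
    exact zero_ne_one (congrArg Prod.fst h1)
  have hcomm : AQuot.gen f₁ 0 * AQuot.gen f₁ 1 = AQuot.gen f₁ 1 * AQuot.gen f₁ 0 := by
    have h := AQuot.mk_eq_zero f₁
    conv at h => enter [1, 2]; rw [show f₁ = _ from rfl]
    rw [map_sub, map_mul, map_mul] at h
    exact sub_eq_zero.mp h
  exact ⟨AQuot.not_isMorita_weyl χ (hχ 0) hx₁,
    AQuot.not_isMorita_of_nonsplit (AQuot.mul_comm_of_gen hcomm) σ τ ε hσ (hτ 0) (hτ 1) hε₀ hε₁,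
    fun h ↦ AQuot.not_isMorita_weyl σ (hσ 0) hx₃ h.symm⟩
end

section
/- Let k be an algebraically closed field of characteristic zero and let q ∈ k be a nonzero scalar that is not a root of unity. Then the quantum plane k⟨x,y⟩/(xy−qyx) is not Morita equivalent to the quantum Weyl algebra k⟨x,y⟩/(xy−qyx−1). -/
universe u

open Polynomial

section EndomorphismLemmas

variable {k V : Type*} [Field k] [AddCommGroup V] [Module k V]

/-- Over an algebraically closed field, an endomorphism annihilating a nonzero vector after
substitution into a nonzero polynomial has an eigenvector. -/
theorem exists_eigenvector_of_aeval_apply_eq_zero [IsAlgClosed k] (T : Module.End k V) (p : k[X])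
    (hp : p ≠ 0) (w : V) (hw : w ≠ 0) (h : aeval T p w = 0) :
    ∃ (a : k) (v : V), v ≠ 0 ∧ T v = a • v := by
  obtain ⟨n, hn⟩ : ∃ n, p.natDegree = n := ⟨_, rfl⟩
  induction n generalizing p w with
  | zero =>
    obtain ⟨c, rfl⟩ := natDegree_eq_zero.1 hn
    have hc : c ≠ 0 := by rintro rfl; simp at hp
    simp [hc, hw, Module.algebraMap_end_apply] at h
  | succ n ih =>
    obtain ⟨a, ha⟩ := IsAlgClosed.exists_root p (by
      rw [degree_eq_natDegree hp, hn]; exact_mod_cast Nat.succ_ne_zero n)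
    obtain ⟨r, rfl⟩ := dvd_iff_isRoot.2 ha
    by_cases hv : T w - a • w = 0
    · exact ⟨a, w, hw, sub_eq_zero.1 hv⟩
    · refine ih r (right_ne_zero_of_mul hp) (T w - a • w) hv ?_ ?_
      · rw [mul_comm, map_mul] at h
        simpa [Module.algebraMap_end_apply] using h
      · rw [natDegree_mul (left_ne_zero_of_mul hp) (right_ne_zero_of_mul hp),
          natDegree_X_sub_C] at hn
        omega

theorem aeval_apply_of_apply_eq_smul (T : Module.End k V) (a : k) (v : V) (h : T v = a • v)
    (p : k[X]) : aeval T p v = p.eval a • v := by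
  induction p using Polynomial.induction_on' with
  | add p r hp hr => simp [hp, hr, add_smul]
  | monomial n c =>
    have : (T ^ n) v = a ^ n • v := by
      induction n with
      | zero => simp
      | succ n ih => rw [pow_succ', Module.End.mul_apply, ih, map_smul, h, smul_smul, pow_succ]
    simp [aeval_monomial, Module.algebraMap_end_apply, this, smul_smul, mul_comm]

/-- If `Z` is surjective and the operators `W d` are weight vectors with distinct weights for
conjugation by `Z`, then a vanishing sum of them has vanishing terms. -/
theorem eq_zero_of_sum_eq_zero_of_weights {ι : Type*} (Z : Module.End k V)
    (hZ : Function.Surjective Z) (c : ι → k) (hc : Function.Injective c) (D : Finset ι)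
    (W : ι → Module.End k V) (hW : ∀ d, Z * W d = c d • (W d * Z)) (hsum : ∑ d ∈ D, W d = 0) :
    ∀ d ∈ D, W d = 0 := by
  classical
  induction D using Finset.induction_on generalizing W with
  | empty => simp
  | insert e D he ih =>
    have hD : ∀ d ∈ D, W d = 0 := by
      have key : (∑ d ∈ D, (c d - c e) • W d) * Z = 0 := by
        have h1 : Z * ∑ d ∈ insert e D, W d - c e • ((∑ d ∈ insert e D, W d) * Z) = 0 := by
          rw [hsum]; simp
        rw [Finset.mul_sum, Finset.sum_mul, Finset.smul_sum, ← Finset.sum_sub_distrib,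
          Finset.sum_insert he, hW, sub_self, zero_add] at h1
        rw [Finset.sum_mul, ← h1]
        exact Finset.sum_congr rfl fun d _ => by
          rw [hW, sub_smul, sub_mul, smul_mul_assoc, smul_mul_assoc]
      have h0 : ∑ d ∈ D, (c d - c e) • W d = 0 := by
        ext s
        obtain ⟨t, rfl⟩ := hZ s
        exact LinearMap.congr_fun key t
      intro d hd
      have := ih (fun d => (c d - c e) • W d) (fun d => by
        rw [mul_smul_comm, hW, smul_mul_assoc, smul_comm]) h0 d hd
      refine (smul_eq_zero.1 this).resolve_left (sub_ne_zero.2 fun h => he ?_)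
      rwa [← hc h]
    intro d hd
    rcases Finset.mem_insert.1 hd with rfl | hd
    · rwa [Finset.sum_insert he, Finset.sum_eq_zero hD, add_zero] at hsum
    · exact hD d hd

/-- Faithfulness of graded pieces of the quantum Weyl algebra on modules where the normal element
`Z` acts injectively. -/
theorem aeval_mul_pow_ne_zero [IsAlgClosed k] [Nontrivial V] (q α β : k) (hq0 : q ≠ 0)
    (hq : ∀ n : ℕ, 1 ≤ n → q ^ n ≠ 1) (hα : α ≠ 0) (hβ : β ≠ 0) (X Y Z : Module.End k V)
    (hZ : Function.Injective Z) (hXZ : X * Z = q • (Z * X)) (hZY : Z * Y = q • (Y * Z))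
    (hYX : Y * X = α • (β • Z - 1)) (hXY : X * Y = α • ((β * q) • Z - 1))
    (p : k[X]) (hp : p ≠ 0) (d : ℕ) : aeval Z p * X ^ d ≠ 0 := by
  intro h
  have hqinj : ∀ m n : ℕ, q ^ m = q ^ n → m = n := by
    have : ∀ m n : ℕ, m < n → q ^ m ≠ q ^ n := fun m n hmn he => by
      refine hq (n - m) (by omega) (mul_left_cancel₀ (pow_ne_zero m hq0) ?_)
      rw [← pow_add, mul_one, he]; congr 1; omega
    intro m n he
    rcases lt_trichotomy m n with h | h | h
    · exact absurd he (this _ _ h)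
    · exact h
    · exact absurd he.symm (this _ _ h)
  have hroots : ∀ f : ℕ → k, Function.Injective f → ¬ ∀ n, p.eval (f n) = 0 := fun f hf h0 =>
    hp (eq_zero_of_infinite_isRoot p ((Set.infinite_range_of_injective hf).mono
      (by rintro _ ⟨n, rfl⟩; exact h0 n)))
  obtain ⟨v, hv0, hv⟩ : ∃ v : V, v ≠ 0 ∧ X v = 0 := by
    by_contra! hinj
    have hXpow : ∀ n (v : V), v ≠ 0 → (X ^ n) v ≠ 0 := by
      intro n v hv
      induction n with
      | zero => simpa
      | succ n ih => rw [pow_succ', Module.End.mul_apply]; exact hinj _ ih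
    obtain ⟨s, hs⟩ := exists_ne (0 : V)
    obtain ⟨l, v, hv, hlv⟩ := exists_eigenvector_of_aeval_apply_eq_zero Z p hp _ (hXpow d s hs)
      (LinearMap.congr_fun h s)
    have hl : l ≠ 0 := by
      rintro rfl
      exact hv (hZ (by simpa using hlv))
    have hw : ∀ n, Z ((X ^ n) v) = (l * q⁻¹ ^ n) • (X ^ n) v := by
      intro n
      induction n with
      | zero => simpa
      | succ n ih =>
        have := LinearMap.congr_fun hXZ ((X ^ n) v)
        simp only [Module.End.mul_apply, LinearMap.smul_apply, ih, map_smul] at this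
        rw [pow_succ' X, Module.End.mul_apply, ← inv_smul_smul₀ hq0 (Z _), ← this, smul_smul]
        congr 1
        ring
    refine hroots (fun n => l * q⁻¹ ^ (d + n)) (fun m n hmn => ?_) fun n => ?_
    · have := hqinj (d + m) (d + n) (by simpa [hl] using hmn)
      omega
    · have h1 := LinearMap.congr_fun h ((X ^ n) v)
      rw [Module.End.mul_apply, ← Module.End.mul_apply (X ^ d), ← pow_add,
        aeval_apply_of_apply_eq_smul Z _ _ (hw (d + n))] at h1
      exact (smul_eq_zero.1 h1).resolve_right (hXpow _ _ hv)
  have hZv : Z v = β⁻¹ • v := by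
    have h1 := LinearMap.congr_fun hYX v
    simp only [Module.End.mul_apply, hv, map_zero, LinearMap.smul_apply, LinearMap.sub_apply,
      Module.End.one_apply] at h1
    rw [eq_inv_smul_iff₀ hβ]
    exact sub_eq_zero.1 ((smul_eq_zero.1 h1.symm).resolve_left hα)
  have hw : ∀ n, Z ((Y ^ n) v) = (β⁻¹ * q ^ n) • (Y ^ n) v := by
    intro n
    induction n with
    | zero => simpa
    | succ n ih =>
      have := LinearMap.congr_fun hZY ((Y ^ n) v)
      simp only [Module.End.mul_apply, LinearMap.smul_apply, ih, map_smul] at this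
      rw [pow_succ' Y, Module.End.mul_apply, this, smul_smul]
      congr 1
      ring
  have hX : ∀ n, X ((Y ^ (n + 1)) v) = (α * (q ^ (n + 1) - 1)) • (Y ^ n) v := by
    intro n
    have := LinearMap.congr_fun hXY ((Y ^ n) v)
    simp only [Module.End.mul_apply, LinearMap.smul_apply, LinearMap.sub_apply,
      Module.End.one_apply, hw] at this
    rw [pow_succ' Y, Module.End.mul_apply, this, smul_smul, mul_smul α, sub_smul, one_smul]
    congr 3
    field_simp
    ring
  have hne : ∀ n, α * (q ^ (n + 1) - 1) ≠ 0 := fun n =>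
    mul_ne_zero hα (sub_ne_zero.2 (hq _ (by omega)))
  have hYpow : ∀ n, (Y ^ n) v ≠ 0 := by
    intro n hn
    induction n with
    | zero => exact hv0 (by simpa using hn)
    | succ n ih =>
      have := hX n
      rw [hn, map_zero] at this
      exact ih ((smul_eq_zero.1 this.symm).resolve_left (hne n))
  have hXY' : ∀ m n, ∃ c : k, c ≠ 0 ∧ (X ^ m) ((Y ^ (m + n)) v) = c • (Y ^ n) v := by
    intro m
    induction m with
    | zero => intro n; exact ⟨1, one_ne_zero, by simp⟩
    | succ m ih =>
      intro n
      obtain ⟨c, hc, h⟩ := ih n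
      refine ⟨α * (q ^ (m + n + 1) - 1) * c, mul_ne_zero (hne _) hc, ?_⟩
      rw [pow_succ X, Module.End.mul_apply, show m + 1 + n = m + n + 1 by omega, hX, map_smul, h,
        smul_smul]
  refine hroots (fun n => β⁻¹ * q ^ n) (fun m n hmn => hqinj m n (by simpa [hβ] using hmn))
    fun n => ?_
  obtain ⟨c, hc, hcn⟩ := hXY' d n
  have h1 := LinearMap.congr_fun h ((Y ^ (d + n)) v)
  rw [Module.End.mul_apply, hcn, map_smul, aeval_apply_of_apply_eq_smul Z _ _ (hw n)] at h1
  exact (smul_eq_zero.1 ((smul_eq_zero.1 h1).resolve_left hc)).resolve_right (hYpow n)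

end EndomorphismLemmas

section QuantumWeyl

variable {k B : Type*} [Field k] [Ring B] [Algebra k B]

/-- A subspace stable under generators of an algebra is stable under the algebra. -/
theorem smul_mem_of_adjoin_eq_top {x y : B}
    (h : Algebra.adjoin k {x, y} = ⊤) {M : Type*} [AddCommGroup M] [Module k M]
    [Module B M] [IsScalarTower k B M] (N : Submodule k M) (hx : ∀ w ∈ N, x • w ∈ N)
    (hy : ∀ w ∈ N, y • w ∈ N) (c : B) {w : M} (hw : w ∈ N) : c • w ∈ N := by
  have hc : c ∈ Algebra.adjoin k {x, y} := h ▸ Algebra.mem_top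
  induction hc using Algebra.adjoin_induction generalizing w with
  | mem c hc =>
    rcases hc with rfl | hc
    · exact hx w hw
    · exact Set.mem_singleton_iff.1 hc ▸ hy w hw
  | algebraMap r => rw [algebraMap_smul]; exact N.smul_mem _ hw
  | add a b _ _ ha hb => rw [add_smul]; exact add_mem (ha hw) (hb hw)
  | mul a b _ _ ha hb => rw [mul_smul]; exact ha (hb hw)

/-- A `k`-linear map commuting with the generators is linear over the algebra they generate. -/
def LinearMap.ofAdjoinEqTop {x y : B} (h : Algebra.adjoin k {x, y} = ⊤) {M N : Type*}
    [AddCommGroup M] [Module k M] [Module B M] [IsScalarTower k B M] [AddCommGroup N]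
    [Module k N] [Module B N] [IsScalarTower k B N]
    (f : M →ₗ[k] N) (hx : ∀ m, f (x • m) = x • f m) (hy : ∀ m, f (y • m) = y • f m) :
    M →ₗ[B] N :=
  { f with
    map_smul' := fun c m => by
      have := smul_mem_of_adjoin_eq_top h f.graph (fun w hw => ?_) (fun w hw => ?_) c
        (w := (m, f m)) (by simp)
      · exact ((LinearMap.mem_graph_iff f _).1 this).symm
      · rw [LinearMap.mem_graph_iff] at hw ⊢
        exact (congrArg (x • ·) hw).trans (hx _).symm
      · rw [LinearMap.mem_graph_iff] at hw ⊢
        exact (congrArg (y • ·) hw).trans (hy _).symm }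

/-- `B` is generated by `x` and `y`, which satisfy the relation of the quantum Weyl algebra. -/
structure IsQuantumWeyl (q : k) (x y : B) : Prop where
  rel : x * y = q • (y * x) + 1
  adjoin : Algebra.adjoin k {x, y} = ⊤

/-- The powers of `x` in nonnegative degrees and of `y` in nonpositive degrees. -/
def gradedPow (x y : B) : ℤ → B
  | (n : ℕ) => x ^ n
  | Int.negSucc n => y ^ (n + 1)

theorem gradedPow_natCast (x y : B) (n : ℕ) : gradedPow x y n = x ^ n := rfl

theorem gradedPow_neg_natCast (x y : B) (n : ℕ) : gradedPow x y (-n) = y ^ n := by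
  cases n with
  | zero => exact (pow_zero x).trans (pow_zero y).symm
  | succ n => rfl

namespace IsQuantumWeyl

variable {q : k} {x y : B} (h : IsQuantumWeyl q x y)

/-- The normal element `(q - 1)yx + 1 = xy - yx` of the quantum Weyl algebra. -/
def normalElt (q : k) (x y : B) : B := (q - 1) • (y * x) + 1

include h

theorem smul_smul_eq {M : Type*} [AddCommGroup M] [Module k M] [Module B M]
    [IsScalarTower k B M] (m : M) : x • y • m = q • y • x • m + m := by
  rw [← mul_smul, h.rel, add_smul, smul_assoc, mul_smul, one_smul]

theorem eq_bot_or_eq_top {S : Type*} [AddCommGroup S] [Module k S] [Module B S]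
    [IsScalarTower k B S] [IsSimpleModule B S] (N : Submodule k S) (hx : ∀ w ∈ N, x • w ∈ N)
    (hy : ∀ w ∈ N, y • w ∈ N) : N = ⊥ ∨ N = ⊤ := by
  let N' : Submodule B S := { N with
    smul_mem' := fun c w hw => smul_mem_of_adjoin_eq_top h.adjoin N hx hy c hw }
  rcases IsSimpleOrder.eq_bot_or_eq_top N' with hN | hN
  · left; ext w; exact Submodule.ext_iff.1 hN w
  · right; ext w; exact Submodule.ext_iff.1 hN w

theorem mul_normalElt_left : x * normalElt q x y = q • (normalElt q x y * x) := by
  simp only [normalElt, mul_add, mul_smul_comm, ← mul_assoc, h.rel, add_mul, smul_mul_assoc,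
    one_mul, mul_one]
  module

theorem normalElt_mul_right : normalElt q x y * y = q • (y * normalElt q x y) := by
  simp only [normalElt, mul_add, mul_smul_comm, mul_assoc, h.rel, add_mul, smul_mul_assoc,
    one_mul, mul_one]
  module

omit h in
theorem yx_eq (hq1 : q ≠ 1) : y * x = (q - 1)⁻¹ • (normalElt q x y - 1) := by
  rw [normalElt, add_sub_cancel_right, inv_smul_smul₀ (sub_ne_zero.2 hq1)]

theorem xy_eq (hq1 : q ≠ 1) : x * y = (q - 1)⁻¹ • (q • normalElt q x y - 1) := by
  rw [eq_inv_smul_iff₀ (sub_ne_zero.2 hq1), h.rel, normalElt]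
  module

theorem mul_aeval_left (p : k[X]) : x * aeval (normalElt q x y) p =
    aeval (normalElt q x y) (p.comp (C q * X)) * x := by
  have key : ∀ n : ℕ, x * normalElt q x y ^ n = (q • normalElt q x y) ^ n * x := by
    intro n
    induction n with
    | zero => simp
    | succ n ih => rw [pow_succ, ← mul_assoc, ih, mul_assoc, h.mul_normalElt_left, pow_succ,
        mul_assoc, smul_mul_assoc]
  induction p using Polynomial.induction_on' with
  | add p r hp hr => simp [mul_add, add_mul, hp, hr]
  | monomial n c =>
    simp only [aeval_comp, aeval_monomial, map_mul, aeval_C, aeval_X, ← Algebra.smul_def,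
      mul_smul_comm, key, smul_mul_assoc]

theorem mul_aeval_right (hq0 : q ≠ 0) (p : k[X]) : y * aeval (normalElt q x y) p =
    aeval (normalElt q x y) (p.comp (C q⁻¹ * X)) * y := by
  have key : ∀ n : ℕ, y * normalElt q x y ^ n = (q⁻¹ • normalElt q x y) ^ n * y := by
    intro n
    induction n with
    | zero => simp
    | succ n ih => rw [pow_succ, ← mul_assoc, ih, mul_assoc, pow_succ, mul_assoc, smul_mul_assoc,
        h.normalElt_mul_right, inv_smul_smul₀ hq0]
  induction p using Polynomial.induction_on' with
  | add p r hp hr => simp [mul_add, add_mul, hp, hr]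
  | monomial n c =>
    simp only [aeval_comp, aeval_monomial, map_mul, aeval_C, aeval_X, ← Algebra.smul_def,
      mul_smul_comm, key, smul_mul_assoc]

theorem exists_mul_gradedPow_left (hq1 : q ≠ 1) (d : ℤ) : ∃ f : k[X],
    x * gradedPow x y d = aeval (normalElt q x y) f * gradedPow x y (d + 1) := by
  obtain ⟨n, rfl | rfl⟩ := d.eq_nat_or_neg
  · refine ⟨1, ?_⟩
    rw [← Nat.cast_succ, gradedPow_natCast, gradedPow_natCast, pow_succ', map_one, one_mul]
  · cases n with
    | zero => exact ⟨1, by simp [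
        show gradedPow x y 0 = 1 from pow_zero x, show gradedPow x y 1 = x from pow_one x]⟩
    | succ n =>
      refine ⟨C (q - 1)⁻¹ * (C q * X - 1), ?_⟩
      rw [show -((n + 1 : ℕ) : ℤ) + 1 = -(n : ℤ) by push_cast; ring, gradedPow_neg_natCast,
        gradedPow_neg_natCast, pow_succ', ← mul_assoc, h.xy_eq hq1]
      simp [← Algebra.smul_def]

omit h in
theorem exists_mul_gradedPow_right (hq1 : q ≠ 1) (d : ℤ) : ∃ f : k[X],
    y * gradedPow x y d = aeval (normalElt q x y) f * gradedPow x y (d - 1) := by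
  obtain ⟨n, rfl | rfl⟩ := d.eq_nat_or_neg
  · cases n with
    | zero => exact ⟨1, by simp [show gradedPow x y 0 = 1 from pow_zero x,
        show gradedPow x y (-1) = y from pow_one y]⟩
    | succ n =>
      refine ⟨C (q - 1)⁻¹ * (X - 1), ?_⟩
      rw [show ((n + 1 : ℕ) : ℤ) - 1 = (n : ℤ) by push_cast; ring, gradedPow_natCast,
        gradedPow_natCast, pow_succ', ← mul_assoc, yx_eq (x := x) (y := y) hq1]
      simp [← Algebra.smul_def]
  · refine ⟨1, ?_⟩
    rw [show -(n : ℤ) - 1 = -((n + 1 : ℕ) : ℤ) by push_cast; ring, gradedPow_neg_natCast,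
      gradedPow_neg_natCast, pow_succ', map_one, one_mul]

/-- Every element of the quantum Weyl algebra is a combination of powers of `x` and `y` with
coefficients that are polynomials in the normal element. -/
theorem exists_eq_sum (hq0 : q ≠ 0) (hq1 : q ≠ 1) (b : B) : ∃ P : ℤ →₀ k[X],
    b = ∑ d ∈ P.support, aeval (normalElt q x y) (P d) * gradedPow x y d := by
  let Φ : (ℤ →₀ k[X]) →ₗ[k] B := Finsupp.lsum k fun d =>
    (LinearMap.mulRight k (gradedPow x y d)).comp (aeval (normalElt q x y)).toLinearMap
  have hΦ : ∀ d p, Φ (Finsupp.single d p) = aeval (normalElt q x y) p * gradedPow x y d := by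
    intro d p
    simp [Φ]
  have hx : ∀ P, x * Φ P ∈ LinearMap.range Φ := by
    intro P
    induction P using Finsupp.induction_linear with
    | zero => simp
    | add P Q hP hQ => rw [map_add, mul_add]; exact add_mem hP hQ
    | single d p =>
      obtain ⟨f, hf⟩ := h.exists_mul_gradedPow_left hq1 d
      refine ⟨Finsupp.single (d + 1) (p.comp (C q * X) * f), ?_⟩
      rw [hΦ, hΦ, ← mul_assoc, h.mul_aeval_left, mul_assoc, hf, map_mul, mul_assoc]
  have hy : ∀ P, y * Φ P ∈ LinearMap.range Φ := by
    intro P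
    induction P using Finsupp.induction_linear with
    | zero => simp
    | add P Q hP hQ => rw [map_add, mul_add]; exact add_mem hP hQ
    | single d p =>
      obtain ⟨f, hf⟩ := exists_mul_gradedPow_right (x := x) (y := y) hq1 d
      refine ⟨Finsupp.single (d - 1) (p.comp (C q⁻¹ * X) * f), ?_⟩
      rw [hΦ, hΦ, ← mul_assoc, h.mul_aeval_right hq0, mul_assoc, hf, map_mul, mul_assoc]
  obtain ⟨P, hP⟩ := smul_mem_of_adjoin_eq_top h.adjoin (LinearMap.range Φ)
    (by rintro _ ⟨P, rfl⟩; exact hx P) (by rintro _ ⟨P, rfl⟩; exact hy P) b (w := 1)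
    ⟨Finsupp.single 0 1, by
      rw [hΦ, map_one, one_mul]; exact pow_zero x⟩
  refine ⟨P, ?_⟩
  rw [← mul_one b, ← smul_eq_mul, ← hP]
  simp [Φ, Finsupp.sum]

theorem normalElt_mul_gradedPow (hq0 : q ≠ 0) (d : ℤ) : normalElt q x y * gradedPow x y d =
    q ^ (-d) • (gradedPow x y d * normalElt q x y) := by
  obtain ⟨n, rfl | rfl⟩ := d.eq_nat_or_neg
  · rw [gradedPow_natCast, zpow_neg, zpow_natCast, eq_inv_smul_iff₀ (pow_ne_zero n hq0)]
    induction n with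
    | zero => simp
    | succ n ih => rw [pow_succ' q, mul_smul, pow_succ x, ← mul_assoc, ← smul_mul_assoc, ih,
        mul_assoc, mul_assoc, h.mul_normalElt_left, mul_smul_comm]
  · rw [gradedPow_neg_natCast, neg_neg, zpow_natCast]
    induction n with
    | zero => simp
    | succ n ih => rw [pow_succ y, ← mul_assoc, ih, smul_mul_assoc, mul_assoc,
        h.normalElt_mul_right, mul_smul_comm, smul_smul, pow_succ, mul_assoc]

/-- The normal element acts by zero on every simple module with nonzero annihilator. -/
theorem normalElt_smul_eq_zero [IsAlgClosed k] (hq0 : q ≠ 0) (hq : ∀ n : ℕ, 1 ≤ n → q ^ n ≠ 1)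
    {S : Type*} [AddCommGroup S] [Module k S] [Module B S] [IsScalarTower k B S]
    [IsSimpleModule B S] (b : B) (hb : b ≠ 0) (hbS : ∀ s : S, b • s = 0) (s : S) :
    normalElt q x y • s = 0 := by
  have hq1 : q ≠ 1 := by simpa using hq 1 le_rfl
  set z := normalElt q x y with hz
  have : Nontrivial S := IsSimpleModule.nontrivial B S
  let ρ : B →ₐ[k] Module.End k S := Algebra.lsmul k k S
  have hρ : ∀ c s, ρ c s = c • s := fun _ _ => rfl
  have hxz : ∀ s : S, x • z • s = q • z • x • s := fun s => by
    rw [← mul_smul, h.mul_normalElt_left, smul_assoc, mul_smul]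
  have hzy : ∀ s : S, z • y • s = q • y • z • s := fun s => by
    rw [← mul_smul, h.normalElt_mul_right, smul_assoc, mul_smul]
  by_contra hs
  have hker : LinearMap.ker (ρ z) = ⊥ := by
    refine (h.eq_bot_or_eq_top _ (fun s hs => ?_) fun s hs => ?_).resolve_right fun h => hs ?_
    · rw [LinearMap.mem_ker, hρ] at hs ⊢
      refine (smul_eq_zero.1 ?_).resolve_left hq0
      rw [← hxz, hs, smul_zero]
    · rw [LinearMap.mem_ker, hρ] at hs ⊢
      rw [hzy, hs, smul_zero, smul_zero]
    · rw [← hρ, ← LinearMap.mem_ker, h]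
      trivial
  have hrange : LinearMap.range (ρ z) = ⊤ := by
    refine (h.eq_bot_or_eq_top _ ?_ ?_).resolve_left fun h => hs ?_
    · rintro _ ⟨s, rfl⟩
      rw [hρ, hxz, ← hρ]
      exact Submodule.smul_mem _ _ ⟨_, rfl⟩
    · rintro _ ⟨s, rfl⟩
      refine ⟨q⁻¹ • y • s, ?_⟩
      rw [map_smul, hρ, hρ, hzy, inv_smul_smul₀ hq0]
    · have : ρ z s ∈ LinearMap.range (ρ z) := ⟨s, rfl⟩
      rwa [h] at this
  obtain ⟨P, hP⟩ := h.exists_eq_sum hq0 hq1 b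
  obtain ⟨d, hd⟩ : P.support.Nonempty := by
    by_contra hempty
    rw [Finset.not_nonempty_iff_eq_empty.1 hempty, Finset.sum_empty] at hP
    exact hb hP
  have hzpow : Function.Injective fun d : ℤ => q ^ (-d) := by
    have key : ∀ n : ℕ, 1 ≤ n → ∀ m : ℤ, q ^ (m + n) ≠ q ^ m := fun n hn m he => by
      rw [zpow_add₀ hq0, zpow_natCast] at he
      exact hq n hn (mul_left_cancel₀ (zpow_ne_zero m hq0) (he.trans (mul_one _).symm))
    intro a b hab
    rcases lt_trichotomy a b with hlt | heq | hlt
    · refine absurd hab ?_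
      have := key (b - a).toNat (by omega) (-b)
      rwa [show -b + ((b - a).toNat : ℤ) = -a by omega] at this
    · exact heq
    · refine absurd hab.symm ?_
      have := key (a - b).toNat (by omega) (-a)
      rwa [show -a + ((a - b).toNat : ℤ) = -b by omega] at this
  have hzero := eq_zero_of_sum_eq_zero_of_weights (ρ z) (LinearMap.range_eq_top.1 hrange)
    (fun d : ℤ => q ^ (-d)) hzpow P.support (fun d => ρ (aeval z (P d) * gradedPow x y d))
    (fun d => by
      have hcomm : z * aeval z (P d) = aeval z (P d) * z := by
        simpa using congrArg (aeval z) (mul_comm X (P d))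
      rw [← map_mul, ← map_mul, ← map_smul, ← mul_assoc, hcomm, mul_assoc,
        h.normalElt_mul_gradedPow hq0, mul_smul_comm, mul_assoc]) (by
      rw [← map_sum, ← hP]
      ext s
      exact hbS s) d hd
  have hPd := Finsupp.mem_support_iff.1 hd
  have hinj := LinearMap.ker_eq_bot.1 hker
  have hα : (q - 1)⁻¹ ≠ 0 := inv_ne_zero (sub_ne_zero.2 hq1)
  have hXZ : ρ x * ρ z = q • (ρ z * ρ x) := by
    rw [← map_mul, h.mul_normalElt_left, map_smul, map_mul]
  have hZY : ρ z * ρ y = q • (ρ y * ρ z) := by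
    rw [← map_mul, h.normalElt_mul_right, map_smul, map_mul]
  have hYX : ρ y * ρ x = (q - 1)⁻¹ • (ρ z - 1) := by
    rw [← map_mul, yx_eq hq1, map_smul, map_sub, map_one]
  have hXY : ρ x * ρ y = (q - 1)⁻¹ • (q • ρ z - 1) := by
    rw [← map_mul, h.xy_eq hq1, map_smul, map_sub, map_one, map_smul]
  obtain ⟨n, rfl | rfl⟩ := d.eq_nat_or_neg
  · refine aeval_mul_pow_ne_zero q (q - 1)⁻¹ 1 hq0 hq hα one_ne_zero (ρ x) (ρ y) (ρ z) hinj hXZ hZY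
      (by rw [one_smul, hYX]) (by rw [one_mul, hXY]) _ hPd n ?_
    rwa [gradedPow_natCast, map_mul, ← aeval_algHom_apply, map_pow] at hzero
  · refine aeval_mul_pow_ne_zero q⁻¹ (q - 1)⁻¹ q (inv_ne_zero hq0)
      (fun n hn => by rw [inv_pow]; exact inv_ne_one.2 (hq n hn)) hα hq0 (ρ y) (ρ x) (ρ z) hinj
      (by rw [hZY, inv_smul_smul₀ hq0]) (by rw [hXZ, inv_smul_smul₀ hq0])
      hXY (by rw [mul_inv_cancel₀ hq0, one_smul, hYX]) _ hPd n ?_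
    rwa [gradedPow_neg_natCast, map_mul, ← aeval_algHom_apply, map_pow] at hzero

/-- A simple module killed by the normal element is one-dimensional. -/
theorem exists_eigenvalues [IsAlgClosed k] (hq1 : q ≠ 1)
    {S : Type*} [AddCommGroup S] [Module k S] [Module B S] [IsScalarTower k B S]
    [IsSimpleModule B S] (hz : ∀ s : S, normalElt q x y • s = 0) :
    ∃ a b : k, a ≠ 0 ∧ (∀ s : S, x • s = a • s) ∧ (∀ s : S, y • s = b • s) ∧
      ∃ v : S, v ≠ 0 ∧ ∀ s : S, ∃ c : k, c • v = s := by
  have : Nontrivial S := IsSimpleModule.nontrivial B S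
  let ρ : B →ₐ[k] Module.End k S := Algebra.lsmul k k S
  have hρ : ∀ c s, ρ c s = c • s := fun _ _ => rfl
  obtain ⟨g, hg, hyx, hxy⟩ : ∃ g : k, g ≠ 0 ∧ (∀ s : S, y • x • s = g • s) ∧
      ∀ s : S, x • y • s = g • s := by
    refine ⟨-(q - 1)⁻¹, neg_ne_zero.2 (inv_ne_zero (sub_ne_zero.2 hq1)), fun s => ?_, fun s => ?_⟩
    · rw [← mul_smul, yx_eq hq1, smul_assoc, sub_smul, hz, one_smul, zero_sub, smul_neg, neg_smul]
    · rw [← mul_smul, h.xy_eq hq1, smul_assoc, sub_smul, smul_assoc, hz, one_smul, smul_zero,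
        zero_sub, smul_neg, neg_smul]
  obtain ⟨a, v, hv, hav⟩ : ∃ (a : k) (v : S), v ≠ 0 ∧ ρ x v = a • v := by
    by_contra! hnone
    obtain ⟨s, hs⟩ := exists_ne (0 : S)
    have hrange : LinearMap.range (ρ x - 1) = ⊤ := by
      refine (h.eq_bot_or_eq_top _ ?_ ?_).resolve_left fun hbot => ?_
      · rintro _ ⟨s, rfl⟩
        refine ⟨x • s, ?_⟩
        simp [hρ, smul_sub]
      · rintro _ ⟨s, rfl⟩
        refine ⟨y • s, ?_⟩
        simp [hρ, smul_sub, hxy, hyx]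
      · have : (ρ x - 1) s ∈ LinearMap.range (ρ x - 1) := ⟨s, rfl⟩
        rw [hbot, Submodule.mem_bot, LinearMap.sub_apply, sub_eq_zero] at this
        exact hnone 1 s hs (by rw [this, one_smul, Module.End.one_apply])
    let N : Submodule k S :=
      { carrier := {w | ∃ (n : ℕ) (p : k[X]), (ρ x ^ n) w = aeval (ρ x) p s}
        zero_mem' := ⟨0, 0, by simp⟩
        add_mem' := by
          rintro w₁ w₂ ⟨n₁, p₁, h₁⟩ ⟨n₂, p₂, h₂⟩
          refine ⟨n₁ + n₂, X ^ n₂ * p₁ + X ^ n₁ * p₂, ?_⟩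
          rw [map_add, map_add, map_mul, map_mul, LinearMap.add_apply, Module.End.mul_apply,
            Module.End.mul_apply, ← h₁, ← h₂, map_pow, map_pow, aeval_X,
            ← Module.End.mul_apply (ρ x ^ n₂), ← Module.End.mul_apply (ρ x ^ n₁), ← pow_add,
            ← pow_add, add_comm n₂]
        smul_mem' := by
          rintro c w ⟨n, p, h⟩
          exact ⟨n, c • p, by rw [map_smul, h, map_smul, LinearMap.smul_apply]⟩ }
    have hN : N = ⊤ := by
      refine (h.eq_bot_or_eq_top N ?_ ?_).resolve_left fun hbot => ?_
      · rintro w ⟨n, p, h⟩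
        refine ⟨n, X * p, ?_⟩
        rw [map_mul, Module.End.mul_apply, ← h, aeval_X, ← Module.End.mul_apply (ρ x), ← pow_succ',
          pow_succ, Module.End.mul_apply, hρ]
      · rintro w ⟨n, p, h⟩
        refine ⟨n + 1, g • p, ?_⟩
        rw [map_smul (aeval (ρ x)), LinearMap.smul_apply, ← h, pow_succ, Module.End.mul_apply,
          hρ, hxy, map_smul]
      · have : s ∈ N := ⟨0, 1, by simp⟩
        rw [hbot] at this
        exact hs this
    obtain ⟨t, ht⟩ := LinearMap.range_eq_top.1 hrange s
    obtain ⟨n, p, hp⟩ : t ∈ N := hN ▸ Submodule.mem_top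
    have hne : X ^ n - (X - 1) * p ≠ 0 := fun h0 => by
      simpa using congrArg (eval 1) h0
    obtain ⟨a, v, hv, hav⟩ := exists_eigenvector_of_aeval_apply_eq_zero (ρ x) _ hne s hs (by
      rw [map_sub, map_mul, LinearMap.sub_apply, Module.End.mul_apply, ← hp, map_pow, map_sub,
        aeval_X, map_one, ← Module.End.mul_apply, ← ((Commute.refl (ρ x)).pow_left n |>.sub_right
          (Commute.one_right _)).eq, Module.End.mul_apply, ht, sub_self])
    exact hnone a v hv hav
  have hx : ∀ s : S, x • s = a • s := by
    have hker : LinearMap.ker (ρ x - a • 1) = ⊤ := by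
      refine (h.eq_bot_or_eq_top _ (fun s hs => ?_) fun s hs => ?_).resolve_left fun hbot => ?_
      · rw [LinearMap.mem_ker, LinearMap.sub_apply, hρ, LinearMap.smul_apply,
          Module.End.one_apply, sub_eq_zero] at hs ⊢
        rw [hs, smul_comm, hs]
      · rw [LinearMap.mem_ker, LinearMap.sub_apply, hρ, LinearMap.smul_apply,
          Module.End.one_apply, sub_eq_zero] at hs ⊢
        rw [hxy, ← hyx, hs, smul_comm]
      · have : v ∈ LinearMap.ker (ρ x - a • 1) := by simp [hav]
        rw [hbot] at this
        exact hv this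
    intro s
    have : s ∈ LinearMap.ker (ρ x - a • 1) := hker ▸ Submodule.mem_top
    simpa [hρ, sub_eq_zero] using this
  have ha : a ≠ 0 := by
    rintro rfl
    have := hyx v
    rw [hx, zero_smul, smul_zero] at this
    exact hv ((smul_eq_zero.1 this.symm).resolve_left hg)
  have hy : ∀ s : S, y • s = (a⁻¹ * g) • s := fun s => by
    rw [mul_smul, ← hyx, hx, smul_comm y, inv_smul_smul₀ ha]
  refine ⟨a, a⁻¹ * g, ha, hx, hy, v, hv, fun s => ?_⟩
  have hspan : Submodule.span k {v} = ⊤ := by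
    refine (h.eq_bot_or_eq_top _ (fun s hs => ?_) fun s hs => ?_).resolve_left fun hbot => hv ?_
    · rw [hx]; exact Submodule.smul_mem _ _ hs
    · rw [hy]; exact Submodule.smul_mem _ _ hs
    · simpa using hbot
  exact Submodule.mem_span_singleton.1 (hspan ▸ Submodule.mem_top)

/-- If `S` is a simple module with nonzero annihilator over the quantum Weyl algebra, and `M` is
an extension of a module containing `S ⊕ S` by a quotient of `S`, then `S` maps to `M` nontrivially
modulo the kernel of the extension. -/
theorem exists_linearMap_comp_ne_zero [IsAlgClosed k] (hq0 : q ≠ 0)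
    (hq : ∀ n : ℕ, 1 ≤ n → q ^ n ≠ 1)
    {S M T : Type*} [AddCommGroup S] [Module k S] [Module B S] [IsScalarTower k B S]
    [AddCommGroup M] [Module k M] [Module B M] [IsScalarTower k B M]
    [AddCommGroup T] [Module k T] [Module B T] [IsScalarTower k B T]
    [IsSimpleModule B S] (b : B) (hb : b ≠ 0) (hbS : ∀ s : S, b • s = 0)
    (i : S →ₗ[B] M) (p : M →ₗ[B] T) (hp : Function.Surjective p)
    (hip : LinearMap.ker p ≤ LinearMap.range i) (j : S × S →ₗ[B] T) (hj : Function.Injective j) :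
    ∃ f : S →ₗ[B] M, p ∘ₗ f ≠ 0 := by
  have hq1 : q ≠ 1 := by simpa using hq 1 le_rfl
  obtain ⟨a, b, ha, hx, hy, v, hv, hspan⟩ :=
    h.exists_eigenvalues hq1 (h.normalElt_smul_eq_zero hq0 hq b hb hbS)
  have key : ∀ w : S × S, ∃ m c, p m = j w ∧ x • m - a • m = (c : k) • i v := by
    intro w
    obtain ⟨m, hm⟩ := hp (j w)
    have hxw : x • w = a • w := Prod.ext (hx _) (hx _)
    obtain ⟨s, hs⟩ := hip (show x • m - a • m ∈ LinearMap.ker p by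
      rw [LinearMap.mem_ker, map_sub, map_smul, LinearMap.map_smul_of_tower, hm, ← map_smul, hxw,
        LinearMap.map_smul_of_tower, sub_self])
    obtain ⟨c, rfl⟩ := hspan s
    exact ⟨m, c, hm, by rw [← hs, LinearMap.map_smul_of_tower]⟩
  obtain ⟨m, w, hw, hm, hxm⟩ : ∃ (m : M) (w : S × S), w ≠ 0 ∧ p m = j w ∧ x • m = a • m := by
    obtain ⟨m₁, c₁, h₁, h₁'⟩ := key (v, 0)
    obtain ⟨m₂, c₂, h₂, h₂'⟩ := key (0, v)
    by_cases hc : c₁ = 0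
    · refine ⟨m₁, (v, 0), by simp [hv], h₁, ?_⟩
      rwa [hc, zero_smul, sub_eq_zero] at h₁'
    · refine ⟨c₂ • m₁ - c₁ • m₂, c₂ • (v, 0) - c₁ • (0, v), ?_, ?_, ?_⟩
      · simp [hc, hv, Prod.ext_iff]
      · rw [map_sub, map_sub, LinearMap.map_smul_of_tower, LinearMap.map_smul_of_tower,
          LinearMap.map_smul_of_tower, LinearMap.map_smul_of_tower, h₁, h₂]
      · rw [sub_eq_iff_eq_add] at h₁' h₂'
        rw [smul_sub, smul_comm, smul_comm x, h₁', h₂']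
        module
  have hyw : y • w = b • w := Prod.ext (hy _) (hy _)
  have hym : y • m = b • m := by
    obtain ⟨s, hs⟩ := hip (show y • m - b • m ∈ LinearMap.ker p by
      rw [LinearMap.mem_ker, map_sub, map_smul, LinearMap.map_smul_of_tower, hm, ← map_smul, hyw,
        LinearMap.map_smul_of_tower, sub_self])
    rw [eq_comm, sub_eq_iff_eq_add] at hs
    have hab : a * b = q * (a * b) + 1 := by
      have := h.smul_smul_eq v
      rw [hx, hy, hx, hy, smul_smul, smul_smul, smul_smul] at this
      refine smul_left_injective k hv ?_
      change (a * b) • v = (q * (a * b) + 1) • v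
      rw [this, add_smul, one_smul, mul_comm a, mul_assoc]
    have h2 := h.smul_smul_eq m
    rw [hs, hxm, smul_comm y, hs, smul_add, smul_comm x, hxm, ← map_smul i x, hx,
      LinearMap.map_smul_of_tower] at h2
    have h3 : (a * (1 - q)) • i s = (0 : M) := by
      have h4 : (a * (1 - q)) • i s = (q * (a * b) + 1 - a * b) • m := by
        have h5 : a • i s + b • a • m - (q • a • (i s + b • m) + m) = 0 := sub_eq_zero.2 h2
        rw [← sub_eq_zero, ← h5]
        module
      rw [h4, ← hab, sub_self, zero_smul]
    rw [hs, (smul_eq_zero.1 h3).resolve_left (mul_ne_zero ha (sub_ne_zero.2 hq1.symm)), zero_add]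
  have hinj : Function.Injective (LinearMap.toSpanSingleton k S v) :=
    smul_left_injective k hv
  let e := LinearEquiv.ofBijective (LinearMap.toSpanSingleton k S v) ⟨hinj, hspan⟩
  refine ⟨LinearMap.ofAdjoinEqTop h.adjoin (LinearMap.toSpanSingleton k M m ∘ₗ e.symm.toLinearMap)
    (fun s => ?_)
    (fun s => ?_), fun h0 => hw ?_⟩
  · rw [hx, map_smul]
    simp only [LinearMap.comp_apply, LinearMap.toSpanSingleton_apply]
    rw [smul_comm x, hxm, smul_comm]
  · rw [hy, map_smul]
    simp only [LinearMap.comp_apply, LinearMap.toSpanSingleton_apply]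
    rw [smul_comm y, hym, smul_comm]
  · have h1 : p ((1 : k) • m) = 0 := by
      have := LinearMap.congr_fun h0 (e 1)
      rw [LinearMap.comp_apply] at this
      change p ((e.symm (e 1)) • m) = 0 at this
      rwa [e.symm_apply_apply] at this
    rw [one_smul, hm] at h1
    exact hj (h1.trans (map_zero j).symm)

end IsQuantumWeyl

end QuantumWeyl

section Categorical

open CategoryTheory

/-- There are a simple object `S` that does not cogenerate the projective objects, and a right
exact sequence `S ⟶ M ⟶ T` with `T` containing `S ⊕ S`, such that all morphisms `S ⟶ M` vanish
in `T`. -/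
def HasRigidExtension (C : Type*) [Category C] [Preadditive C] : Prop :=
  ∃ (S M T P Q : C) (f : Q ⟶ P) (i : S ⟶ M) (p : M ⟶ T) (j₁ j₂ : S ⟶ T) (r₁ r₂ : T ⟶ S)
    (w : i ≫ p = 0), Simple S ∧ Projective P ∧ f ≠ 0 ∧ (∀ g : P ⟶ S, f ≫ g = 0) ∧ Epi p ∧
      (ShortComplex.mk i p w).Exact ∧ j₁ ≫ r₁ = 𝟙 S ∧ j₁ ≫ r₂ = 0 ∧ j₂ ≫ r₁ = 0 ∧
      j₂ ≫ r₂ = 𝟙 S ∧ ∀ g : S ⟶ M, g ≫ p = 0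

theorem HasRigidExtension.of_equivalence {C D : Type*} [Category C] [Category D] [Abelian C]
    [Abelian D] (e : C ≌ D) (h : HasRigidExtension C) : HasRigidExtension D := by
  obtain ⟨S, M, T, P, Q, f, i, p, j₁, j₂, r₁, r₂, w, hS, hP, hf, hfS, hp, hex, h₁₁, h₁₂, h₂₁, h₂₂,
    hM⟩ := h
  have : e.functor.PreservesZeroMorphisms := inferInstance
  let F := e.functor
  refine ⟨F.obj S, F.obj M, F.obj T, F.obj P, F.obj Q, F.map f, F.map i, F.map p, F.map j₁,
    F.map j₂, F.map r₁, F.map r₂, by rw [← F.map_comp, w, F.map_zero], simple_obj F S,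
    (e.map_projective_iff P).2 hP, fun h0 => hf (F.map_injective (by rw [h0, F.map_zero])),
    fun g => ?_, inferInstance, hex.map F, by rw [← F.map_comp, h₁₁, F.map_id],
    by rw [← F.map_comp, h₁₂, F.map_zero], by rw [← F.map_comp, h₂₁, F.map_zero],
    by rw [← F.map_comp, h₂₂, F.map_id], fun g => ?_⟩
  · obtain ⟨g, rfl⟩ := F.map_surjective g
    rw [← F.map_comp, hfS, F.map_zero]
  · obtain ⟨g, rfl⟩ := F.map_surjective g
    rw [← F.map_comp, hM, F.map_zero]

/-- A nonzero map into a projective module that is killed by all maps to `S` yields a nonzero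
annihilator of `S`. -/
theorem exists_ne_zero_forall_smul_eq_zero {R P S : Type*} [Ring R] [AddCommGroup P] [Module R P]
    [AddCommGroup S] [Module R S] [Module.Projective R P] (v : P) (hv : v ≠ 0)
    (h : ∀ g : P →ₗ[R] S, g v = 0) : ∃ b : R, b ≠ 0 ∧ ∀ s : S, b • s = 0 := by
  obtain ⟨φ, hφ⟩ := Module.projective_def'.1 ‹Module.Projective R P›
  obtain ⟨t, ht⟩ : ∃ t, φ v t ≠ 0 := by
    by_contra! h0
    have h1 : φ v = 0 := Finsupp.ext h0
    have h2 := LinearMap.congr_fun hφ v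
    rw [LinearMap.comp_apply, h1, map_zero] at h2
    exact hv h2.symm
  exact ⟨φ v t, ht, fun s => h (LinearMap.toSpanSingleton R S s ∘ₗ Finsupp.lapply t ∘ₗ φ)⟩

open scoped ModuleCat in
theorem IsQuantumWeyl.not_hasRigidExtension {k B : Type u} [Field k] [IsAlgClosed k] [Ring B]
    [Algebra k B] {q : k} {x y : B} (h : IsQuantumWeyl q x y) (hq0 : q ≠ 0)
    (hq : ∀ n : ℕ, 1 ≤ n → q ^ n ≠ 1) : ¬ HasRigidExtension (ModuleCat.{u} B) := by
  rintro ⟨S, M, T, P, Q, f, i, p, j₁, j₂, r₁, r₂, w, hS, hP, hf, hfS, hp, hex, h₁₁, h₁₂, h₂₁, h₂₂,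
    hM⟩
  have hS' : IsSimpleModule B S := inferInstance
  have hP' : Module.Projective B P := inferInstance
  obtain ⟨t, ht⟩ : ∃ t, f t ≠ 0 := by
    by_contra! h0
    exact hf (by ext t; exact h0 t)
  obtain ⟨b, hb, hbS⟩ := exists_ne_zero_forall_smul_eq_zero (S := S) (f t) ht fun g =>
    ConcreteCategory.congr_hom (hfS (ModuleCat.ofHom g)) t
  let j : S × S →ₗ[B] T := j₁.hom.coprod j₂.hom
  have hj : Function.Injective j := by
    rw [← LinearMap.ker_eq_bot, LinearMap.ker_eq_bot']
    rintro ⟨s₁, s₂⟩ h0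
    have e₁ : r₁ (j₁ s₁ + j₂ s₂) = 0 := (congrArg r₁ h0).trans (map_zero _)
    have e₂ : r₂ (j₁ s₁ + j₂ s₂) = 0 := (congrArg r₂ h0).trans (map_zero _)
    have a₁₁ : r₁ (j₁ s₁) = s₁ := ConcreteCategory.congr_hom h₁₁ s₁
    have a₁₂ : r₂ (j₁ s₁) = 0 := ConcreteCategory.congr_hom h₁₂ s₁
    have a₂₁ : r₁ (j₂ s₂) = 0 := ConcreteCategory.congr_hom h₂₁ s₂
    have a₂₂ : r₂ (j₂ s₂) = s₂ := ConcreteCategory.congr_hom h₂₂ s₂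
    rw [map_add, a₁₁, a₂₁, add_zero] at e₁
    rw [map_add, a₁₂, a₂₂, zero_add] at e₂
    rw [e₁, e₂]; rfl
  obtain ⟨g, hg⟩ := h.exists_linearMap_comp_ne_zero hq0 hq b hb hbS i.hom p.hom
    ((ModuleCat.epi_iff_surjective p).1 hp)
    ((ShortComplex.moduleCat_exact_iff_ker_sub_range _).1 hex) j hj
  exact hg (ModuleCat.hom_ext_iff.1 (hM (ModuleCat.ofHom g)))

end Categorical

/-- The space `V` as a module along a representation on it. -/
def RepModule {k A V : Type*} [Field k] [Ring A] [Algebra k A] [AddCommGroup V] [Module k V]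
    (_ : A →ₐ[k] Module.End k V) : Type _ := V

namespace RepModule

variable {k A V : Type*} [Field k] [Ring A] [Algebra k A] [AddCommGroup V] [Module k V]
  (φ : A →ₐ[k] Module.End k V)

instance : AddCommGroup (RepModule φ) := inferInstanceAs (AddCommGroup V)

instance : Module k (RepModule φ) := inferInstanceAs (Module k V)

instance : Module A (RepModule φ) := Module.compHom V φ.toRingHom

theorem smul_def (a : A) (v : RepModule φ) : a • v = (φ a (v : V) : V) := rfl

instance : IsScalarTower k A (RepModule φ) :=
  ⟨fun c a v => by
    rw [smul_def, smul_def, map_smul]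
    rfl⟩

end RepModule

section QuantumPlane

open CategoryTheory

universe v

theorem hasRigidExtension_of_lift {k A : Type v} [Field k] [Ring A] [Algebra k A] {x y : A}
    (hgen : Algebra.adjoin k {x, y} = ⊤) (hx : x ≠ 0)
    (φ : A →ₐ[k] Module.End k k) (hφx : φ x = 0) (hφy : φ y = 0)
    (ψ : A →ₐ[k] Module.End k ((k × k) × k))
    (hψx : ψ x = LinearMap.inr k (k × k) k ∘ₗ LinearMap.fst k k k ∘ₗ LinearMap.fst k (k × k) k)
    (hψy : ψ y = LinearMap.inr k (k × k) k ∘ₗ LinearMap.snd k k k ∘ₗ LinearMap.fst k (k × k) k) :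
    HasRigidExtension (ModuleCat.{v} A) := by
  let S := RepModule φ
  let M := RepModule ψ
  have hSx : ∀ s : S, x • s = 0 := fun s => by rw [RepModule.smul_def, hφx]; rfl
  have hSy : ∀ s : S, y • s = 0 := fun s => by rw [RepModule.smul_def, hφy]; rfl
  have hMx : ∀ m : M, x • m = ((0, m.1.1) : (k × k) × k) := fun m => by
    rw [RepModule.smul_def, hψx]; rfl
  have hMy : ∀ m : M, y • m = ((0, m.1.2) : (k × k) × k) := fun m => by
    rw [RepModule.smul_def, hψy]; rfl
  let i : S →ₗ[A] M := LinearMap.ofAdjoinEqTop hgen (M := S) (N := M) (LinearMap.inr k (k × k) k)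
    (fun s => by rw [hSx, hMx]; rfl) (fun s => by rw [hSy, hMy]; rfl)
  let p : M →ₗ[A] S × S :=
    LinearMap.ofAdjoinEqTop hgen (M := M) (N := S × S) (LinearMap.fst k (k × k) k)
      (fun m => by rw [hMx]; exact (Prod.ext (hSx _) (hSx _)).symm)
      (fun m => by rw [hMy]; exact (Prod.ext (hSy _) (hSy _)).symm)
  have : IsSimpleModule A S := (isSimpleModule_iff ..).2
    (is_simple_module_of_finrank_eq_one (A := A) (K := k)
      (show Module.finrank k S = 1 from Module.finrank_self k))
  refine ⟨ModuleCat.of A S, ModuleCat.of A M, ModuleCat.of A (S × S), ModuleCat.of A A,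
    ModuleCat.of A A, ModuleCat.ofHom (LinearMap.toSpanSingleton A A x), ModuleCat.ofHom i,
    ModuleCat.ofHom p, ModuleCat.ofHom (LinearMap.inl A S S), ModuleCat.ofHom (LinearMap.inr A S S),
    ModuleCat.ofHom (LinearMap.fst A S S), ModuleCat.ofHom (LinearMap.snd A S S), ?_, inferInstance,
    (IsProjective.iff_projective A).1 inferInstance, fun h0 => hx ?_, fun g => ?_, ?_, ?_, rfl, rfl,
    rfl, rfl, fun g => ?_⟩
  · exact ModuleCat.hom_ext (LinearMap.ext fun _ => rfl)
  · simpa using ConcreteCategory.congr_hom h0 (1 : A)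
  · ext
    change g.hom ((1 : A) • x) = 0
    rw [one_smul, ← mul_one x, ← smul_eq_mul, map_smul]
    exact hSx _
  · rw [ModuleCat.epi_iff_surjective]
    intro t
    exact ⟨((t, 0) : (k × k) × k), rfl⟩
  · rw [ShortComplex.moduleCat_exact_iff_ker_sub_range]
    intro m hm
    exact ⟨Prod.snd (α := k × k) (β := k) m, Prod.ext (Eq.symm hm) rfl⟩
  · refine ModuleCat.hom_ext (LinearMap.ext fun s => ?_)
    have h1 : x • g.hom s = 0 := by
      rw [← map_smul]
      exact (congrArg g.hom (hSx s)).trans (map_zero _)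
    have h2 : y • g.hom s = 0 := by
      rw [← map_smul]
      exact (congrArg g.hom (hSy s)).trans (map_zero _)
    have e₁ : (g.hom s : (k × k) × k).1.1 = 0 :=
      congrArg (Prod.snd (α := k × k) (β := k)) ((hMx _).symm.trans h1)
    have e₂ : (g.hom s : (k × k) × k).1.2 = 0 :=
      congrArg (Prod.snd (α := k × k) (β := k)) ((hMy _).symm.trans h2)
    exact Prod.ext e₁ e₂

end QuantumPlane

section Presentation

variable {k : Type u} [Field k] (f : FA k)

/-- The images of the two generators in the quotient of the free algebra. -/
def AQuot.gen_s1 (n : Fin 2) : AQuot k f := RingQuot.mkAlgHom k _ (FreeAlgebra.ι k n)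

theorem AQuot.adjoin_gen_s1 : Algebra.adjoin k {gen_s1 f 0, gen_s1 f 1} = ⊤ := by
  have hr : ({gen_s1 f 0, gen_s1 f 1} : Set (AQuot k f)) =
      RingQuot.mkAlgHom k (fun a b : FA k => a = f ∧ b = 0) '' Set.range (FreeAlgebra.ι k) := by
    rw [← Set.range_comp]
    ext a
    simp [Fin.exists_fin_two, gen_s1, eq_comm]
  rw [hr, ← AlgHom.map_adjoin, FreeAlgebra.adjoin_range_ι, Algebra.map_top]
  exact (AlgHom.range_eq_top _).2 (RingQuot.mkAlgHom_surjective k _)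

theorem AQuot.mk_eq_zero_s1 : RingQuot.mkAlgHom k (fun a b : FA k => a = f ∧ b = 0) f = 0 :=
  (RingQuot.mkAlgHom_rel k ⟨rfl, rfl⟩).trans (map_zero _)

theorem AQuot.exists_lift {E : Type*} [Ring E] [Algebra k E] (X Y : E)
    (h : FreeAlgebra.lift k ![X, Y] f = 0) :
    ∃ φ : AQuot k f →ₐ[k] E, φ (gen_s1 f 0) = X ∧ φ (gen_s1 f 1) = Y := by
  refine ⟨RingQuot.liftAlgHom k ⟨FreeAlgebra.lift k ![X, Y], ?_⟩, ?_, ?_⟩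
  · rintro _ _ ⟨rfl, rfl⟩
    rw [h, map_zero]
  · rw [gen_s1, RingQuot.liftAlgHom_mkAlgHom_apply, FreeAlgebra.lift_ι_apply]; rfl
  · rw [gen_s1, RingQuot.liftAlgHom_mkAlgHom_apply, FreeAlgebra.lift_ι_apply]; rfl

theorem isQuantumWeyl_AQuot (q : k) : IsQuantumWeyl q
    (AQuot.gen_s1 (FreeAlgebra.ι k (0 : Fin 2) * FreeAlgebra.ι k (1 : Fin 2) -
        q • (FreeAlgebra.ι k (1 : Fin 2) * FreeAlgebra.ι k (0 : Fin 2)) - 1) 0)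
    (AQuot.gen_s1 (FreeAlgebra.ι k (0 : Fin 2) * FreeAlgebra.ι k (1 : Fin 2) -
        q • (FreeAlgebra.ι k (1 : Fin 2) * FreeAlgebra.ι k (0 : Fin 2)) - 1) 1) where
  rel := by
    have := AQuot.mk_eq_zero_s1 (FreeAlgebra.ι k (0 : Fin 2) * FreeAlgebra.ι k (1 : Fin 2) -
        q • (FreeAlgebra.ι k (1 : Fin 2) * FreeAlgebra.ι k (0 : Fin 2)) - 1)
    rw [map_sub, map_sub, map_smul, map_mul, map_mul, map_one] at this
    exact sub_eq_zero.1 ((sub_sub _ _ _).symm.trans this)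
  adjoin := AQuot.adjoin_gen_s1 _

theorem hasRigidExtension_quantumPlane (q : k) : HasRigidExtension (ModuleCat.{u}
    (AQuot k (FreeAlgebra.ι k (0 : Fin 2) * FreeAlgebra.ι k (1 : Fin 2) -
        q • (FreeAlgebra.ι k (1 : Fin 2) * FreeAlgebra.ι k (0 : Fin 2))))) := by
  set f : FA k := FreeAlgebra.ι k (0 : Fin 2) * FreeAlgebra.ι k (1 : Fin 2) -
    q • (FreeAlgebra.ι k (1 : Fin 2) * FreeAlgebra.ι k (0 : Fin 2)) with hf
  have hlift : ∀ {E : Type u} [Ring E] [Algebra k E] (X Y : E), X * Y = q • (Y * X) →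
      FreeAlgebra.lift k ![X, Y] f = 0 := by
    intro E _ _ X Y h
    simp [hf, h]
  obtain ⟨χ, hχ, -⟩ := AQuot.exists_lift f (1 : k) 0 (hlift _ _ (by simp))
  obtain ⟨φ, hφx, hφy⟩ := AQuot.exists_lift f (0 : Module.End k k) 0 (hlift _ _ (by simp))
  obtain ⟨ψ, hψx, hψy⟩ := AQuot.exists_lift f (E := Module.End k ((k × k) × k))
    (LinearMap.inr k (k × k) k ∘ₗ LinearMap.fst k k k ∘ₗ LinearMap.fst k (k × k) k)
    (LinearMap.inr k (k × k) k ∘ₗ LinearMap.snd k k k ∘ₗ LinearMap.fst k (k × k) k)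
    (hlift _ _ (by ext <;> simp))
  refine hasRigidExtension_of_lift (AQuot.adjoin_gen_s1 f) (fun h0 => ?_) φ hφx hφy ψ hψx hψy
  rw [h0, map_zero] at hχ
  exact zero_ne_one hχ

end Presentation

/-- Over an algebraically closed field of characteristic zero, if `q` is a nonzero scalar
that is not a root of unity, then the quantum plane `k⟨x,y⟩/(xy−qyx)` is not Morita
equivalent to the quantum Weyl algebra `k⟨x,y⟩/(xy−qyx−1)`. -/
theorem statement1 (k : Type u) [Field k] [IsAlgClosed k] [CharZero k]
    (q : k) (hq0 : q ≠ 0) (hq : ∀ n : ℕ, 1 ≤ n → q ^ n ≠ 1) :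
    ¬ IsMorita
      (AQuot k (FreeAlgebra.ι k (0 : Fin 2) * FreeAlgebra.ι k (1 : Fin 2) -
        q • (FreeAlgebra.ι k (1 : Fin 2) * FreeAlgebra.ι k (0 : Fin 2))))
      (AQuot k (FreeAlgebra.ι k (0 : Fin 2) * FreeAlgebra.ι k (1 : Fin 2) -
        q • (FreeAlgebra.ι k (1 : Fin 2) * FreeAlgebra.ι k (0 : Fin 2)) - 1)) := by
  rintro ⟨e⟩
  exact (isQuantumWeyl_AQuot q).not_hasRigidExtension hq0 hq
    ((hasRigidExtension_quantumPlane q).of_equivalence e)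
end

section
/- Let k be an algebraically closed field of characteristic zero. Then the Jordan plane k⟨x,y⟩/(xy−yx+x²) is not Morita equivalent to k⟨x,y⟩/(xy−yx+x²−y). -/
universe u

open CategoryTheory

section Nilpotent

variable {k R : Type*} [Field k] [Ring R] [Algebra k R] {X Y : R}

lemma commutator_pow (h : Y * X - X * Y = X ^ 2) (n : ℕ) :
    Y * X ^ n - X ^ n * Y = (n : R) * X ^ (n + 1) := by
  induction n with
  | zero => simp
  | succ n ih =>
    have e : Y * X ^ (n + 1) - X ^ (n + 1) * Y =
        (Y * X ^ n - X ^ n * Y) * X + X ^ n * (Y * X - X * Y) := by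
      rw [pow_succ]; noncomm_ring
    rw [e, ih, h, mul_assoc, ← pow_succ, ← pow_add]
    push_cast
    rw [add_mul, one_mul]

lemma commutator_aeval_s4 (h : Y * X - X * Y = X ^ 2) (p : Polynomial k) :
    Y * Polynomial.aeval X p - Polynomial.aeval X p * Y =
      Polynomial.aeval X (p.derivative * Polynomial.X ^ 2) := by
  induction p using Polynomial.induction_on' with
  | add p q hp hq =>
    rw [Polynomial.derivative_add, add_mul, map_add, map_add, ← hp, ← hq]
    noncomm_ring
  | monomial n a =>
    have hc := commutator_pow h n
    rw [Polynomial.derivative_monomial, Polynomial.aeval_monomial, map_mul,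
      Polynomial.aeval_monomial, map_mul, map_natCast, map_pow, Polynomial.aeval_X,
      ← mul_assoc, ← Algebra.commutes, mul_assoc, mul_assoc, ← mul_sub, hc]
    rcases n with _ | n
    · simp
    · simp only [Nat.add_sub_cancel]
      rw [mul_assoc, mul_assoc, ← pow_add]

/-- An algebraic element `X` over an algebraically closed field of characteristic zero for which
some `Y` satisfies `[Y, X] = X ^ 2` is nilpotent. -/
lemma isNilpotent_of_commutator_eq_sq [IsAlgClosed k] [CharZero k] (hX : IsIntegral k X)
    (h : Y * X - X * Y = X ^ 2) : IsNilpotent X := by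
  set p := minpoly k X with hp
  have hp0 : p ≠ 0 := minpoly.ne_zero hX
  have hdvd : p ∣ p.derivative * Polynomial.X ^ 2 := by
    apply minpoly.dvd
    rw [← commutator_aeval_s4 h, minpoly.aeval]
    simp
  have hroots : ∀ a ∈ p.roots, a = 0 := by
    intro a ha
    by_contra ha0
    have hr : p.IsRoot a := (Polynomial.mem_roots hp0).1 ha
    have hpos : 0 < p.rootMultiplicity a := (Polynomial.rootMultiplicity_pos hp0).2 hr
    have hd := Polynomial.derivative_rootMultiplicity_of_root hr
    have hd0 : p.derivative ≠ 0 := by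
      intro h0
      have := Polynomial.derivative_eq_zero.1 h0
      rw [Polynomial.eq_C_of_natDegree_eq_zero this] at hr hp0
      simp at hr
      simp [hr] at hp0
    have hne : p.derivative * Polynomial.X ^ 2 ≠ 0 :=
      mul_ne_zero hd0 (pow_ne_zero _ Polynomial.X_ne_zero)
    have hle := Polynomial.rootMultiplicity_le_rootMultiplicity_of_dvd hne hdvd a
    have hz : (Polynomial.X ^ 2 : Polynomial k).rootMultiplicity a = 0 :=
      Polynomial.rootMultiplicity_eq_zero (by simpa using ha0)
    rw [Polynomial.rootMultiplicity_mul hne, hz] at hle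
    omega
  have hs := (IsAlgClosed.splits p).eq_prod_roots_of_monic (minpoly.monic hX)
  rw [Multiset.eq_replicate.2 ⟨rfl, hroots⟩] at hs
  refine ⟨p.roots.card, ?_⟩
  have := minpoly.aeval k X
  rw [← hp, hs] at this
  simpa using this

end Nilpotent

lemma AQuot.induction {k : Type u} [Field k] {f : FA k} {P : AQuot k f → Prop}
    (algebraMap : ∀ c : k, P (algebraMap k _ c))
    (gen : ∀ i, P (RingQuot.mkAlgHom k _ (FreeAlgebra.ι k i)))
    (mul : ∀ a b, P a → P b → P (a * b)) (h_add : ∀ a b, P a → P b → P (a + b))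
    (a : AQuot k f) : P a := by
  obtain ⟨a, rfl⟩ := RingQuot.mkAlgHom_surjective k _ a
  induction a using FreeAlgebra.induction with
  | grade0 r => simpa using algebraMap r
  | grade1 i => exact gen i
  | mul a b ha hb => simpa using mul _ _ ha hb
  | add a b ha hb => simpa using h_add _ _ ha hb

section Transport

variable {k : Type*} [Field k] {A B : Type u} [Ring A] [Ring B]
  (F : ModuleCat.{u} B ⥤ ModuleCat.{u} A)
  (V : Type u) [AddCommGroup V] [Module k V] [Module B V] [SMulCommClass k B V]

/-- Scalar multiplication by `c` on a module `V`, as a morphism of `ModuleCat B`. -/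
abbrev scalarHom (c : k) : ModuleCat.of B V ⟶ ModuleCat.of B V :=
  ModuleCat.ofHom (Module.toModuleEnd B V c)

/-- The action of `k` on `F.obj V` obtained by applying the additive functor `F` to scalars. -/
def transportHom [F.Additive] : k →+* Module.End A (F.obj (ModuleCat.of B V)) where
  toFun c := (F.map (scalarHom V c)).hom
  map_one' := by
    rw [show scalarHom V (1 : k) = 𝟙 (ModuleCat.of B V) by ext; simp, F.map_id]
    rfl
  map_mul' c d := by
    rw [show scalarHom (B := B) V (c * d) = scalarHom V d ≫ scalarHom V c by
      ext; simp [mul_smul], F.map_comp]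
    rfl
  map_zero' := by
    rw [show scalarHom (B := B) V (0 : k) = 0 by ext; simp, F.map_zero]
    rfl
  map_add' c d := by
    rw [show scalarHom (B := B) V (c + d) = scalarHom V c + scalarHom V d by
      ext; simp [add_smul], F.map_add]
    rfl

/-- The `k`-module structure on `F.obj V` given by `transportHom`. -/
abbrev transportModule [F.Additive] : Module k (F.obj (ModuleCat.of B V)) :=
  Module.compHom _ (transportHom F V)

/-- Under an equivalence, the image of `B` generates the regular module `A`. -/
lemma iSup_range_eq_top (e : ModuleCat.{u} B ≌ ModuleCat.{u} A) :
    ⨆ f : e.functor.obj (ModuleCat.of B B) ⟶ ModuleCat.of A A, LinearMap.range f.hom = ⊤ := by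
  set N := ⨆ f : e.functor.obj (ModuleCat.of B B) ⟶ ModuleCat.of A A, LinearMap.range f.hom
    with hN
  let q : ModuleCat.of A A ⟶ ModuleCat.of A (A ⧸ N) := ModuleCat.ofHom N.mkQ
  have hq : ∀ f : e.functor.obj (ModuleCat.of B B) ⟶ ModuleCat.of A A, f ≫ q = 0 := by
    intro f
    ext v
    change N.mkQ (f.hom v) = 0
    rw [Submodule.mkQ_apply, Submodule.Quotient.mk_eq_zero]
    exact le_iSup (fun f : e.functor.obj (ModuleCat.of B B) ⟶ ModuleCat.of A A =>
      LinearMap.range f.hom) f ⟨v, rfl⟩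
  have hG : e.inverse.map q = 0 := by
    ext v
    let g : ModuleCat.of B B ⟶ e.inverse.obj (ModuleCat.of A A) :=
      ModuleCat.ofHom (LinearMap.toSpanSingleton B _ v)
    have h1 := hq ((e.toAdjunction.homEquiv _ _).symm g)
    rw [← Adjunction.homEquiv_naturality_right_symm] at h1
    have h2 : g ≫ e.inverse.map q = 0 := by
      apply (e.toAdjunction.homEquiv _ _).symm.injective
      rw [h1, Adjunction.homEquiv_symm_apply]
      simp
    have h3 := congrArg (fun t => t.hom (1 : B)) h2
    simpa [g] using h3
  have hq0 : q = 0 := e.inverse.map_injective (by rw [hG, Functor.map_zero])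
  have : N.mkQ = 0 := congrArg ModuleCat.Hom.hom hq0
  rwa [← LinearMap.ker_eq_top, Submodule.ker_mkQ] at this

lemma finite_transportModule (e : ModuleCat.{u} B ≌ ModuleCat.{u} A) [e.functor.Additive]
    [FiniteDimensional k V] :
    letI := transportModule (k := k) e.functor V
    FiniteDimensional k (e.functor.obj (ModuleCat.of B V)) := by
  set M := e.functor.obj (ModuleCat.of B V)
  let : Module k M := transportModule e.functor V
  obtain ⟨s, hs⟩ := Submodule.mem_iSup_iff_exists_finset.1
    ((iSup_range_eq_top e).symm ▸ Submodule.mem_top : (1 : A) ∈ ⨆ f :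
      e.functor.obj (ModuleCat.of B B) ⟶ ModuleCat.of A A, LinearMap.range f.hom)
  let ev (m : M) : ModuleCat.of A A ⟶ M := ModuleCat.ofHom (LinearMap.toSpanSingleton A M m)
  have ev_add (m n : M) : ev (m + n) = ev m + ev n := by
    ext; simp [ev]
  have ev_smul (c : k) (m : M) : ev (c • m) = ev m ≫ e.functor.map (scalarHom V c) := by
    ext
    simp [ev]
    rfl
  let θ : M →ₗ[k] (s → V) :=
    { toFun m f := (e.functor.preimage (f.1 ≫ ev m)).hom (1 : B)
      map_add' m n := by
        funext f
        have : e.functor.preimage (f.1 ≫ ev (m + n)) =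
            e.functor.preimage (f.1 ≫ ev m) + e.functor.preimage (f.1 ≫ ev n) := by
          apply e.functor.map_injective
          simp [ev_add]
        rw [this]
        rfl
      map_smul' c m := by
        funext f
        have : e.functor.preimage (f.1 ≫ ev (c • m)) =
            e.functor.preimage (f.1 ≫ ev m) ≫ scalarHom V c := by
          apply e.functor.map_injective
          simp [ev_smul]
        rw [this]
        rfl }
  refine FiniteDimensional.of_injective θ ?_
  rw [injective_iff_map_eq_zero]
  intro m hm
  have h0 (f : s) : f.1 ≫ ev m = 0 := by
    have h1 : e.functor.preimage (f.1 ≫ ev m) = 0 := by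
      apply ModuleCat.hom_ext
      apply LinearMap.ext_ring
      exact congrFun hm f
    rw [← e.functor.map_preimage (f.1 ≫ ev m), h1, Functor.map_zero]
  have hle : (⨆ f ∈ s, LinearMap.range f.hom) ≤ LinearMap.ker (ev m).hom := by
    refine iSup₂_le fun f hf => ?_
    rintro _ ⟨v, rfl⟩
    exact congrArg (fun t => t.hom v) (h0 ⟨f, hf⟩)
  have := hle hs
  simpa [ev] using this

end Transport

section Jordan

variable (k : Type u) [Field k]

/-- The Jordan plane. -/
abbrev JordanPlane : Type u := AQuot k (FreeAlgebra.ι k (0 : Fin 2) * FreeAlgebra.ι k (1 : Fin 2) -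
    FreeAlgebra.ι k (1 : Fin 2) * FreeAlgebra.ι k (0 : Fin 2) +
    FreeAlgebra.ι k (0 : Fin 2) ^ 2)

/-- A module over the Jordan plane with only scalar endomorphisms, finite dimensional over these
scalars, is at most one-dimensional. -/
lemma scalar_of_jordanPlane [IsAlgClosed k] [CharZero k] (M : Type u) [AddCommGroup M]
    [Module (JordanPlane k) M] [Module k M] [SMulCommClass k (JordanPlane k) M]
    [FiniteDimensional k M]
    (hend : ∀ f : M →ₗ[JordanPlane k] M, ∃ c : k, ∀ m, f m = c • m) (g : M →ₗ[k] M) :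
    ∃ c : k, ∀ m, g m = c • m := by
  have : SMulCommClass (JordanPlane k) k M := .symm ..
  let ρ : (JordanPlane k) →+* Module.End k M := Module.toModuleEnd k M
  let q : FA k →ₐ[k] (JordanPlane k) := RingQuot.mkAlgHom k _
  set X := ρ (q (FreeAlgebra.ι k 0)) with hX
  set Y := ρ (q (FreeAlgebra.ι k 1)) with hY
  have hrel : Y * X - X * Y = X ^ 2 := by
    have h0 : q (FreeAlgebra.ι k (0 : Fin 2) * FreeAlgebra.ι k (1 : Fin 2) -
        FreeAlgebra.ι k (1 : Fin 2) * FreeAlgebra.ι k (0 : Fin 2) +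
        FreeAlgebra.ι k (0 : Fin 2) ^ 2) = q 0 := RingQuot.mkAlgHom_rel k ⟨rfl, rfl⟩
    have h1 := congrArg ρ h0
    simp only [map_add, map_sub, map_mul, map_pow, map_zero] at h1
    rw [← hX, ← hY] at h1
    rw [← sub_eq_zero, ← neg_eq_zero, ← h1]
    abel
  have scalar_of_commute (f : Module.End k M)
      (hf : ∀ a : JordanPlane k, ∀ m, f (a • m) = a • f m) : ∃ c : k, ∀ m, f m = c • m :=
    hend { toFun := f, map_add' := map_add f, map_smul' := hf }
  have scalar_algebraMap (c : k) :
      ∃ d : k, ∀ m : M, (algebraMap k (JordanPlane k) c) • m = d • m := by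
    refine scalar_of_commute (ρ (algebraMap k _ c)) fun a m => ?_
    change (algebraMap k (JordanPlane k) c) • a • m = a • (algebraMap k (JordanPlane k) c) • m
    rw [smul_smul, smul_smul, Algebra.commutes]
  have scalar_of_commute_gen (f : Module.End k M) (h0 : f * X = X * f) (h1 : f * Y = Y * f) :
      ∃ c : k, ∀ m, f m = c • m := by
    refine scalar_of_commute f fun a => ?_
    induction a using AQuot.induction with
    | algebraMap c =>
      intro m
      obtain ⟨d, hd⟩ := scalar_algebraMap c
      rw [hd, hd, map_smul]
    | gen i =>
      intro m
      fin_cases i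
      · exact congrArg (fun t : Module.End k M => t m) h0
      · exact congrArg (fun t : Module.End k M => t m) h1
    | mul a b ha hb =>
      intro m
      rw [mul_smul, mul_smul, ha, hb]
    | h_add a b ha hb =>
      intro m
      rw [add_smul, add_smul, map_add, ha, hb]
  have hX0 : X = 0 := by
    obtain ⟨n, hn⟩ := isNilpotent_of_commutator_eq_sq (Algebra.IsIntegral.isIntegral (R := k) X) hrel
    have hind : ∀ j : ℕ, X ^ (j + 1) = 0 → X = 0 := by
      intro j
      induction j with
      | zero => simp
      | succ j ih =>
        intro hj
        apply ih
        obtain ⟨c, hc⟩ := scalar_of_commute_gen (X ^ (j + 1))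
          (by rw [← pow_succ, ← pow_succ']) (by
            have := commutator_pow hrel (j + 1)
            rw [hj, mul_zero, sub_eq_zero] at this
            exact this.symm)
        have hsq : X ^ (j + 1) * X ^ (j + 1) = 0 := by
          rw [← pow_add, show j + 1 + (j + 1) = j + 1 + 1 + j by ring, pow_add, hj, zero_mul]
        ext m
        have h2 := congrArg (fun t : Module.End k M => t m) hsq
        simp only [Module.End.mul_apply, hc, LinearMap.zero_apply, smul_smul, smul_eq_zero,
          mul_self_eq_zero] at h2
        rw [hc, LinearMap.zero_apply, smul_eq_zero]
        exact h2
    exact hind n (by rw [pow_succ, hn, zero_mul])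
  obtain ⟨d, hd⟩ := scalar_of_commute_gen Y (by rw [hX0]; simp) rfl
  have hall (a : JordanPlane k) : ∃ c : k, ∀ m : M, a • m = c • m := by
    induction a using AQuot.induction with
    | algebraMap c => exact scalar_algebraMap c
    | gen i =>
      fin_cases i
      · exact ⟨0, fun m => by
          rw [zero_smul]
          exact congrArg (fun t : Module.End k M => t m) hX0⟩
      · exact ⟨d, hd⟩
    | mul a b ha hb =>
      obtain ⟨c, hc⟩ := ha
      obtain ⟨d, hd⟩ := hb
      exact ⟨c * d, fun m => by rw [mul_smul, mul_smul, hd, hc]⟩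
    | h_add a b ha hb =>
      obtain ⟨c, hc⟩ := ha
      obtain ⟨d, hd⟩ := hb
      exact ⟨c + d, fun m => by rw [add_smul, add_smul, hd, hc]⟩
  refine scalar_of_commute g fun a m => ?_
  obtain ⟨c, hc⟩ := hall a
  rw [hc, hc, map_smul]

/-- A module over a ring Morita equivalent to the Jordan plane whose endomorphisms are all scalar
and which is finite dimensional has no proper nonzero submodule stable under scalars. -/
lemma eq_bot_or_eq_top_of_isMorita [IsAlgClosed k] [CharZero k] {B : Type u} [Ring B]
    (e : ModuleCat.{u} B ≌ ModuleCat.{u} (JordanPlane k)) (V : Type u) [AddCommGroup V] [Module k V]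
    [Module B V] [SMulCommClass k B V] [FiniteDimensional k V]
    (hend : ∀ f : V →ₗ[B] V, ∃ c : k, ∀ v, f v = c • v)
    (S : Submodule B V) (hS : ∀ (c : k), ∀ v ∈ S, c • v ∈ S) : S = ⊥ ∨ S = ⊤ := by
  have : e.functor.Additive := Functor.additive_of_preserves_binary_products _
  set M := e.functor.obj (ModuleCat.of B V)
  let : Module k M := transportModule e.functor V
  have : FiniteDimensional k M := finite_transportModule V e
  have smul_def (c : k) (m : M) : c • m = (e.functor.map (scalarHom V c)).hom m := rfl
  have : SMulCommClass k (JordanPlane k) M :=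
    ⟨fun c a m => map_smul (e.functor.map (scalarHom V c)).hom a m⟩
  have hM (f : M →ₗ[JordanPlane k] M) : ∃ c : k, ∀ m, f m = c • m := by
    obtain ⟨c, hc⟩ := hend (e.functor.preimage (ModuleCat.ofHom f)).hom
    refine ⟨c, fun m => ?_⟩
    have h : e.functor.preimage (ModuleCat.ofHom f) = scalarHom V c := by
      ext v
      exact hc v
    rw [smul_def, ← h, Functor.map_preimage]
    rfl
  let i : ModuleCat.of B S ⟶ ModuleCat.of B V := ModuleCat.ofHom S.subtype
  let p : ModuleCat.of B V ⟶ ModuleCat.of B (V ⧸ S) := ModuleCat.ofHom S.mkQ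
  by_contra! hcon
  have hi : e.functor.map i ≠ 0 := by
    intro h
    have h1 : i = 0 := e.functor.map_injective (by rw [h, Functor.map_zero])
    have h2 : S.subtype = 0 := congrArg ModuleCat.Hom.hom h1
    apply hcon.1
    rw [← S.range_subtype, h2, LinearMap.range_zero]
  have hp : e.functor.map p ≠ 0 := by
    intro h
    have h1 : p = 0 := e.functor.map_injective (by rw [h, Functor.map_zero])
    have h2 : S.mkQ = 0 := congrArg ModuleCat.Hom.hom h1
    apply hcon.2
    rw [← S.ker_mkQ, h2, LinearMap.ker_zero]
  have hip : e.functor.map i ≫ e.functor.map p = 0 := by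
    rw [← Functor.map_comp, show i ≫ p = 0 by ext v; simp [i, p], Functor.map_zero]
  obtain ⟨s, hs⟩ : ∃ s, (e.functor.map i).hom s ≠ 0 := by
    by_contra! h
    exact hi (by ext s; exact h s)
  obtain ⟨m, hm⟩ : ∃ m, (e.functor.map p).hom m ≠ 0 := by
    by_contra! h
    exact hp (by ext s; exact h s)
  obtain ⟨φ, hφ⟩ := Module.Projective.exists_dual_eq_one k hs
  obtain ⟨c, hc⟩ := scalar_of_jordanPlane k M hM (LinearMap.toSpanSingleton k M m ∘ₗ φ)
  have hcm := hc ((e.functor.map i).hom s)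
  rw [LinearMap.comp_apply, hφ, LinearMap.toSpanSingleton_apply, one_smul, smul_def] at hcm
  let pc : ModuleCat.of B (V ⧸ S) ⟶ ModuleCat.of B (V ⧸ S) :=
    ModuleCat.ofHom (S.mapQ S (Module.toModuleEnd B V c) (hS c))
  have hpc : scalarHom V c ≫ p = p ≫ pc := by
    ext v
    rfl
  have hcomp : e.functor.map (scalarHom V c) ≫ e.functor.map p =
      e.functor.map p ≫ e.functor.map pc := by
    rw [← Functor.map_comp, hpc, Functor.map_comp]
  have h1 := congrArg (fun t => t.hom ((e.functor.map i).hom s)) hcomp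
  have h2 := congrArg (fun t => t.hom s) hip
  simp only [ModuleCat.hom_comp, LinearMap.comp_apply, ModuleCat.hom_zero,
    LinearMap.zero_apply] at h1 h2
  rw [← hcm, h2, map_zero] at h1
  exact hm h1

end Jordan

/-- Over an algebraically closed field of characteristic zero, the Jordan plane
`k⟨x,y⟩/(xy−yx+x²)` is not Morita equivalent to `k⟨x,y⟩/(xy−yx+x²−y)`. -/
theorem statement4 (k : Type u) [Field k] [IsAlgClosed k] [CharZero k] :
    ¬ IsMorita
      (AQuot k (FreeAlgebra.ι k (0 : Fin 2) * FreeAlgebra.ι k (1 : Fin 2) -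
        FreeAlgebra.ι k (1 : Fin 2) * FreeAlgebra.ι k (0 : Fin 2) +
        FreeAlgebra.ι k (0 : Fin 2) ^ 2))
      (AQuot k (FreeAlgebra.ι k (0 : Fin 2) * FreeAlgebra.ι k (1 : Fin 2) -
        FreeAlgebra.ι k (1 : Fin 2) * FreeAlgebra.ι k (0 : Fin 2) +
        FreeAlgebra.ι k (0 : Fin 2) ^ 2 - FreeAlgebra.ι k (1 : Fin 2))) := by
  rintro ⟨e⟩
  let f : FA k := FreeAlgebra.ι k (0 : Fin 2) * FreeAlgebra.ι k (1 : Fin 2) -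
        FreeAlgebra.ι k (1 : Fin 2) * FreeAlgebra.ι k (0 : Fin 2) +
        FreeAlgebra.ι k (0 : Fin 2) ^ 2 - FreeAlgebra.ι k (1 : Fin 2)
  let ψ : FA k →ₐ[k] Matrix (Fin 2) (Fin 2) k :=
    FreeAlgebra.lift k ![!![1, 0; 0, 0], !![1, 1; 0, 0]]
  let φ : AQuot k f →ₐ[k] Matrix (Fin 2) (Fin 2) k := RingQuot.liftAlgHom k ⟨ψ, by
    rintro _ _ ⟨rfl, rfl⟩
    ext i j
    fin_cases i <;> fin_cases j <;> simp [f, ψ, pow_two]⟩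
  have hφ (i : Fin 2) : φ (RingQuot.mkAlgHom k _ (FreeAlgebra.ι k i)) =
      ![!![1, 0; 0, 0], !![1, 1; 0, 0]] i := by
    simp [φ, ψ]
  let τ : AQuot k f →ₐ[k] Module.End k (Fin 2 → k) :=
    (Matrix.toLinAlgEquiv' : _ ≃ₐ[k] _).toAlgHom.comp φ
  let : Module (AQuot k f) (Fin 2 → k) := Module.compHom _ τ.toRingHom
  have smul_def (a : AQuot k f) (v : Fin 2 → k) : a • v = (φ a).mulVec v := rfl
  have : SMulCommClass k (AQuot k f) (Fin 2 → k) :=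
    ⟨fun c a v => (map_smul (τ a) c v).symm⟩
  have hlow (a : AQuot k f) : φ a 1 0 = 0 := by
    induction a using AQuot.induction with
    | algebraMap c => simp [Matrix.algebraMap_matrix_apply]
    | gen i => rw [hφ]; fin_cases i <;> simp
    | mul a b ha hb => simp [Matrix.mul_apply, ha, hb]
    | h_add a b ha hb => simp [ha, hb]
  let S : Submodule (AQuot k f) (Fin 2 → k) :=
    { carrier := {v | v 1 = 0}
      add_mem' := fun {v w} hv hw => by
        simp only [Set.mem_ofPred_eq] at hv hw ⊢
        simp [hv, hw]
      zero_mem' := rfl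
      smul_mem' := fun a v hv => by
        simp only [Set.mem_ofPred_eq] at hv ⊢
        simp [smul_def, Matrix.mulVec, dotProduct, hv, hlow] }
  have hend (g : (Fin 2 → k) →ₗ[AQuot k f] (Fin 2 → k)) : ∃ c : k, ∀ v, g v = c • v := by
    have hx (v : Fin 2 → k) := map_smul g (RingQuot.mkAlgHom k _ (FreeAlgebra.ι k 0)) v
    have hy (v : Fin 2 → k) := map_smul g (RingQuot.mkAlgHom k _ (FreeAlgebra.ι k 1)) v
    have hc (c : k) (v : Fin 2 → k) : g (c • v) = c • g v := by
      have hs (w : Fin 2 → k) : c • w = algebraMap k (AQuot k f) c • w := by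
        rw [smul_def, AlgHom.commutes, Algebra.algebraMap_eq_smul_one, Matrix.smul_mulVec,
          Matrix.one_mulVec]
      rw [hs, hs, map_smul]
    simp only [smul_def, hφ] at hx hy
    have ex (v : Fin 2 → k) :
        Matrix.mulVec ((![!![1, 0; 0, 0], !![1, 1; 0, 0]] : Fin 2 → Matrix _ _ k) 0) v =
          ![v 0, 0] := by
      ext i; fin_cases i <;> simp [Matrix.mulVec, dotProduct]
    have ey (v : Fin 2 → k) :
        Matrix.mulVec ((![!![1, 0; 0, 0], !![1, 1; 0, 0]] : Fin 2 → Matrix _ _ k) 1) v =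
          ![v 0 + v 1, 0] := by
      ext i; fin_cases i <;> simp [Matrix.mulVec, dotProduct]
    simp only [ex, ey] at hx hy
    have h10 : g ![1, 0] 1 = 0 := by simpa using congrFun (hx ![1, 0]) 1
    have h20 : g ![0, 1] 0 = 0 := by
      have h0 : (![0, 0] : Fin 2 → k) = 0 := by ext i; fin_cases i <;> rfl
      simpa [h0] using (congrFun (hx ![0, 1]) 0).symm
    have h12 : g ![1, 0] 0 = g ![0, 1] 1 := by simpa [h20] using congrFun (hy ![0, 1]) 0
    refine ⟨g ![0, 1] 1, fun v => ?_⟩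
    have hv : v = v 0 • ![1, 0] + v 1 • ![0, 1] := by
      ext i; fin_cases i <;> simp
    have hg : g v = v 0 • g ![1, 0] + v 1 • g ![0, 1] := by
      conv_lhs => rw [hv, map_add, hc, hc]
    rw [hg]
    ext i
    fin_cases i
    · simp [h12, h20, mul_comm]
    · simp [h10, mul_comm]
  rcases eq_bot_or_eq_top_of_isMorita k e.symm (Fin 2 → k) hend S
    (fun c v hv => by
      change (c • v) 1 = 0
      simp [show v 1 = 0 from hv]) with h | h
  · have h1 : (![1, 0] : Fin 2 → k) ∈ S := show (![1, 0] : Fin 2 → k) 1 = 0 by simp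
    rw [h, Submodule.mem_bot] at h1
    simpa using congrFun h1 0
  · have h1 : (![0, 1] : Fin 2 → k) ∈ S := h ▸ Submodule.mem_top
    have h2 : (![0, 1] : Fin 2 → k) 1 = 0 := h1
    simp at h2
end

section
/- Let k be a field of characteristic zero. Then there is an isomorphism of k-algebras k⟨x,y⟩/(xy−yx+x²−1) ≅ k⟨x,y⟩/(xy−yx+x²−x). -/
universe u

/-- An automorphism of `k⟨x,y⟩` taking `f` to a nonzero scalar multiple of `g` induces an
isomorphism of the quotients by `f` and by `g`. -/
theorem AQuot.nonempty_algEquiv {k : Type u} [Field k] {f g : FA k} (e : FA k ≃ₐ[k] FA k)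
    {c : k} (hc : c ≠ 0) (h : e f = c • g) : Nonempty (AQuot k f ≃ₐ[k] AQuot k g) := by
  have mk_eq_zero (p : FA k) :
      RingQuot.mkAlgHom k (fun a b : FA k => a = p ∧ b = 0) p = 0 := by
    rw [RingQuot.mkAlgHom_rel k (s := fun a b : FA k => a = p ∧ b = 0) ⟨rfl, rfl⟩, map_zero]
  have h' : e.symm g = c⁻¹ • f := by
    rw [AlgEquiv.symm_apply_eq, map_smul, h, inv_smul_smul₀ hc]
  let φ : AQuot k f →ₐ[k] AQuot k g := RingQuot.liftAlgHom k
    ⟨(RingQuot.mkAlgHom k _).comp e.toAlgHom, by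
      rintro _ _ ⟨rfl, rfl⟩
      simp [h, mk_eq_zero]⟩
  let ψ : AQuot k g →ₐ[k] AQuot k f := RingQuot.liftAlgHom k
    ⟨(RingQuot.mkAlgHom k _).comp e.symm.toAlgHom, by
      rintro _ _ ⟨rfl, rfl⟩
      simp [h', mk_eq_zero]⟩
  refine ⟨AlgEquiv.ofAlgHom φ ψ ?_ ?_⟩ <;>
  · apply RingQuot.ringQuot_ext'
    ext i
    simp [φ, ψ]

/-- The automorphism `x ↦ 2x - 1`, `y ↦ 2y` of `k⟨x,y⟩`. -/
noncomputable def FA.affineEquiv (k : Type u) [Field k] [CharZero k] : FA k ≃ₐ[k] FA k :=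
  AlgEquiv.ofAlgHom
    (FreeAlgebra.lift k
      ![(2 : k) • FreeAlgebra.ι k (0 : Fin 2) - 1, (2 : k) • FreeAlgebra.ι k (1 : Fin 2)])
    (FreeAlgebra.lift k
      ![(2 : k)⁻¹ • (FreeAlgebra.ι k (0 : Fin 2) + 1), (2 : k)⁻¹ • FreeAlgebra.ι k (1 : Fin 2)])
    (by
      ext i
      fin_cases i <;> simp [smul_sub])
    (by
      ext i
      fin_cases i <;> simp)

/-- Over a field of characteristic zero, there is a `k`-algebra isomorphism
`k⟨x,y⟩/(xy−yx+x²−1) ≅ k⟨x,y⟩/(xy−yx+x²−x)`. -/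
theorem statement5 (k : Type u) [Field k] [CharZero k] :
    Nonempty
      ((AQuot k (FreeAlgebra.ι k (0 : Fin 2) * FreeAlgebra.ι k (1 : Fin 2) -
          FreeAlgebra.ι k (1 : Fin 2) * FreeAlgebra.ι k (0 : Fin 2) +
          FreeAlgebra.ι k (0 : Fin 2) ^ 2 - 1)) ≃ₐ[k]
        (AQuot k (FreeAlgebra.ι k (0 : Fin 2) * FreeAlgebra.ι k (1 : Fin 2) -
          FreeAlgebra.ι k (1 : Fin 2) * FreeAlgebra.ι k (0 : Fin 2) +
          FreeAlgebra.ι k (0 : Fin 2) ^ 2 - FreeAlgebra.ι k (0 : Fin 2)))) := by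
 
  refine AQuot.nonempty_algEquiv (FA.affineEquiv k) (c := (4 : k)) (by norm_num) ?_
  simp only [FA.affineEquiv, AlgEquiv.ofAlgHom_apply, map_sub, map_add, map_mul, map_pow, map_one,
    FreeAlgebra.lift_ι_apply, Matrix.cons_val_zero, Matrix.cons_val_one, ofNat_smul_eq_nsmul]
  noncomm_ring
end

section
/- Let k be a field of characteristic zero. The center of the k-algebra k⟨x,y⟩/(xy−yx+x, x²) (the quotient of the free algebra by the two-sided ideal generated by xy−yx+x and x²) is trivial, i.e., equals k·1. -/
universe u

/-- The quotient of the free algebra `k⟨x,y⟩` by the two-sided ideal generated by `f` and `g`. -/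
abbrev AQuot2 (k : Type u) [Field k] (f g : FA k) : Type u :=
  RingQuot (fun a b : FA k => (a = f ∨ a = g) ∧ b = 0)

open Polynomial in
/-- If `x y = (y - 1) x`, then `x p(y) = p(y - 1) x` for every polynomial `p`. -/
theorem mul_aeval_eq_aeval_comp_mul {R A : Type*} [CommRing R] [Ring A] [Algebra R A] {x y : A}
    (h : x * y = (y - 1) * x) (p : R[X]) :
    x * aeval y p = aeval y (p.comp (X - 1)) * x := by
  induction p using Polynomial.induction_on' with
  | add p q hp hq => simp only [map_add, mul_add, add_comp, add_mul, hp, hq]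
  | monomial n a =>
    have hn : x * y ^ n = (y - 1) ^ n * x := SemiconjBy.pow_right h n
    rw [← C_mul_X_pow_eq_monomial, C_mul_comp, X_pow_comp]
    simp only [map_mul, map_pow, aeval_C, aeval_X, map_sub, map_one]
    rw [← mul_assoc, ← Algebra.commutes a x, mul_assoc, hn, mul_assoc]

open Polynomial in
/-- Normal form: if `x y = (y - 1) x` and `x² = 0`, the elements `p(y) + q(y) x` are closed under
multiplication, so they exhaust the algebra generated by `x` and `y`. -/
theorem exists_aeval_add_aeval_mul {R A : Type*} [CommRing R] [Ring A] [Algebra R A] {x y : A}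
    (h : x * y = (y - 1) * x) (hx : x * x = 0) {z : A} (hz : z ∈ Algebra.adjoin R {x, y}) :
    ∃ p q : R[X], z = aeval y p + aeval y q * x := by
  induction hz using Algebra.adjoin_induction with
  | mem z hz =>
    rcases hz with rfl | rfl
    · exact ⟨0, 1, by simp⟩
    · exact ⟨X, 0, by simp⟩
  | algebraMap r => exact ⟨C r, 0, by simp⟩
  | add z w _ _ hz hw =>
    obtain ⟨p, q, rfl⟩ := hz
    obtain ⟨r, s, rfl⟩ := hw
    exact ⟨p + r, q + s, by simp only [map_add, add_mul]; abel⟩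
  | mul z w _ _ hz hw =>
    obtain ⟨p, q, rfl⟩ := hz
    obtain ⟨r, s, rfl⟩ := hw
    refine ⟨p * r, p * s + q * r.comp (X - 1), ?_⟩
    have hs : aeval y q * x * (aeval y s * x) = 0 := by
      rw [mul_assoc, ← mul_assoc x, mul_aeval_eq_aeval_comp_mul h, mul_assoc _ x x, hx, mul_zero,
        mul_zero]
    have hr : aeval y q * x * aeval y r = aeval y q * aeval y (r.comp (X - 1)) * x := by
      rw [mul_assoc, mul_aeval_eq_aeval_comp_mul h, mul_assoc]
    rw [mul_add, add_mul, add_mul, hs, hr]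
    simp only [map_add, map_mul, add_mul, mul_assoc]
    abel

open Polynomial in
/-- In characteristic zero, a polynomial invariant under `X ↦ X - 1` is constant. -/
theorem Polynomial.eq_C_of_comp_X_sub_one_eq {R : Type*} [CommRing R] [IsDomain R] [CharZero R]
    {p : R[X]} (h : p.comp (X - 1) = p) : p = C (p.eval 0) := by
  have hn : ∀ n : ℕ, p.eval (n : R) = p.eval 0 := by
    intro n
    induction n with
    | zero => simp
    | succ n ih =>
      rw [← ih]
      conv_lhs => rw [← h]
      simp [eval_comp]
  refine eq_of_infinite_eval_eq p _ ((Set.infinite_range_of_injective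
    (Nat.cast_injective (R := R))).mono ?_)
  rintro _ ⟨n, rfl⟩
  simpa using hn n

open Polynomial in
theorem aeval_diagonal_fin_two {k : Type*} [Field k] (a b p : k[X]) :
    aeval (!![a, 0; 0, b] : Matrix (Fin 2) (Fin 2) k[X]) p = !![p.comp a, 0; 0, p.comp b] := by
  induction p using Polynomial.induction_on with
  | C c =>
    ext i j : 1
    fin_cases i <;> fin_cases j <;> simp [Matrix.algebraMap_matrix_apply]
  | add p q hp hq => simp [hp, hq]
  | monomial n c hp =>
    rw [pow_succ, ← mul_assoc, map_mul, hp, aeval_X]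
    simp [mul_assoc]

/-- Over a field of characteristic zero, the center of `k⟨x,y⟩/(xy−yx+x, x²)` is trivial,
i.e. it consists exactly of the scalar multiples of the identity. -/
theorem statement7 (k : Type u) [Field k] [CharZero k] :
    Subalgebra.center k
      (AQuot2 k
        (FreeAlgebra.ι k (0 : Fin 2) * FreeAlgebra.ι k (1 : Fin 2) -
          FreeAlgebra.ι k (1 : Fin 2) * FreeAlgebra.ι k (0 : Fin 2) +
          FreeAlgebra.ι k (0 : Fin 2))
        (FreeAlgebra.ι k (0 : Fin 2) ^ 2)) = ⊥ := by
  set f : FA k := FreeAlgebra.ι k (0 : Fin 2) * FreeAlgebra.ι k (1 : Fin 2) -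
    FreeAlgebra.ι k (1 : Fin 2) * FreeAlgebra.ι k (0 : Fin 2) + FreeAlgebra.ι k (0 : Fin 2) with hf
  set g : FA k := FreeAlgebra.ι k (0 : Fin 2) ^ 2 with hg
  let r : FA k → FA k → Prop := fun a b => (a = f ∨ a = g) ∧ b = 0
  let π : FA k →ₐ[k] AQuot2 k f g := RingQuot.mkAlgHom k r
  have hπ : Function.Surjective π := RingQuot.mkAlgHom_surjective k r
  set x : AQuot2 k f g := π (FreeAlgebra.ι k 0) with hxdef
  set y : AQuot2 k f g := π (FreeAlgebra.ι k 1) with hydef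
  have hxy : x * y = (y - 1) * x := by
    have h : π f = π 0 := RingQuot.mkAlgHom_rel k (s := r) ⟨Or.inl rfl, rfl⟩
    simp only [hf, map_add, map_sub, map_mul, map_zero, ← hxdef, ← hydef] at h
    rw [sub_mul, one_mul, ← sub_eq_zero, ← h]
    abel
  have hxx : x * x = 0 := by
    have h : π g = π 0 := RingQuot.mkAlgHom_rel k (s := r) ⟨Or.inr rfl, rfl⟩
    rw [← pow_two, hxdef, ← map_pow]
    exact h.trans (map_zero π)
  have hgen (z : AQuot2 k f g) : z ∈ Algebra.adjoin k {x, y} := by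
    obtain ⟨w, rfl⟩ := hπ z
    induction w using FreeAlgebra.induction with
    | grade0 c => simpa only [AlgHom.commutes] using Subalgebra.algebraMap_mem _ c
    | grade1 i => fin_cases i <;> exact Algebra.subset_adjoin (by simp [hxdef, hydef])
    | mul a b ha hb => simpa only [map_mul] using mul_mem ha hb
    | add a b ha hb => simpa only [map_add] using add_mem ha hb
  let X' : Matrix (Fin 2) (Fin 2) (Polynomial k) := !![0, 1; 0, 0]
  let Y' : Matrix (Fin 2) (Fin 2) (Polynomial k) :=
    !![Polynomial.X, 0; 0, Polynomial.X - 1]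
  let ψ : FA k →ₐ[k] Matrix (Fin 2) (Fin 2) (Polynomial k) := FreeAlgebra.lift k ![X', Y']
  have hψ : ∀ ⦃a b : FA k⦄, r a b → ψ a = ψ b := by
    rintro a b ⟨rfl | rfl, rfl⟩
    · ext i j : 1
      fin_cases i <;> fin_cases j <;> simp [ψ, hf, X', Y']
    · ext i j : 1
      fin_cases i <;> fin_cases j <;> simp [ψ, hg, X', pow_two]
  let φ : AQuot2 k f g →ₐ[k] Matrix (Fin 2) (Fin 2) (Polynomial k) :=
    RingQuot.liftAlgHom k ⟨ψ, hψ⟩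
  have hφπ (w : FA k) : φ (π w) = ψ w := RingQuot.liftAlgHom_mkAlgHom_apply k ψ hψ w
  have hφx : φ x = X' := (hφπ _).trans (by simp [ψ])
  have hφy : φ y = Y' := (hφπ _).trans (by simp [ψ])
  refine le_antisymm (fun z hz => ?_) bot_le
  rw [Subalgebra.mem_center_iff] at hz
  obtain ⟨p, q, rfl⟩ := exists_aeval_add_aeval_mul hxy hxx (hgen z)
  have hq : Polynomial.aeval y q * x = 0 := by
    have h := hz y
    have hp : y * Polynomial.aeval y p = Polynomial.aeval y p * y := by
      simpa using congrArg (Polynomial.aeval y) (mul_comm Polynomial.X p)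
    have hq' : y * Polynomial.aeval y q = Polynomial.aeval y q * y := by
      simpa using congrArg (Polynomial.aeval y) (mul_comm Polynomial.X q)
    rw [mul_add, add_mul, hp, ← mul_assoc, hq', mul_assoc _ x y, hxy, sub_mul, one_mul, mul_sub,
      ← mul_assoc] at h
    exact sub_eq_self.mp (add_left_cancel h).symm
  rw [hq, add_zero] at hz ⊢
  have hp := congrArg φ (hz x)
  rw [map_mul, map_mul, ← Polynomial.aeval_algHom_apply, hφx, hφy, aeval_diagonal_fin_two] at hp
  have hcomp : p.comp (Polynomial.X - 1) = p := by
    simpa [X'] using congrFun (congrFun hp 0) 1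
  rw [Polynomial.eq_C_of_comp_X_sub_one_eq hcomp, Polynomial.aeval_C]
  exact Subalgebra.algebraMap_mem _ _
end

section
/- Let k be an algebraically closed field. The polynomial ring k[t] in one variable is strongly cancellative: for every n ≥ 1 and every k-algebra B, every k-algebra isomorphism k[t] ⊗_k k[t_1,…,t_n] ≅ B ⊗_k k[t_1,…,t_n] implies that B is isomorphic to k[t] as a k-algebra. -/
open scoped TensorProduct

universe u

namespace MvPolynomial

theorem exists_eq_C_of_dvd_C {R σ : Type*} [CommRing R] [IsDomain R] {a : R} (ha : a ≠ 0)
    {f : MvPolynomial σ R} (h : f ∣ C a) : ∃ b, f = C b := by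
  obtain ⟨g, hg⟩ := h
  have hfg : f * g ≠ 0 := by rw [← hg]; simpa using ha
  have hdeg := congrArg totalDegree hg
  rw [totalDegree_C, totalDegree_mul_of_isDomain (left_ne_zero_of_mul hfg)
    (right_ne_zero_of_mul hfg)] at hdeg
  exact ⟨_, totalDegree_eq_zero_iff_eq_C.mp (by omega)⟩

/-- A nonzero prime ideal of `R` contains a prime element as soon as `R[τ]` is factorial. -/
theorem exists_prime_mem_of_uniqueFactorizationMonoid {R : Type*} (τ : Type*) [CommRing R]
    [IsDomain R] [UniqueFactorizationMonoid (MvPolynomial τ R)] {I : Ideal R} [I.IsPrime]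
    (hI : I ≠ ⊥) : ∃ p ∈ I, Prime p := by
  obtain ⟨a, haI, ha⟩ := Submodule.exists_mem_ne_zero_of_ne_bot hI
  obtain ⟨s, hs, hsa⟩ := UniqueFactorizationMonoid.exists_prime_factors
    (C a : MvPolynomial τ R) (by simpa using ha)
  have hmem : s.prod ∈ I.comap (constantCoeff (σ := τ)) :=
    Ideal.mem_of_dvd _ hsa.symm.dvd (by simpa using haI)
  obtain ⟨f, hf, hfI⟩ := (Ideal.IsPrime.multiset_prod_mem_iff_exists_mem inferInstance s).mp hmem
  obtain ⟨p, rfl⟩ := exists_eq_C_of_dvd_C ha ((Multiset.dvd_prod hf).trans hsa.dvd)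
  exact ⟨p, by simpa using hfI, (prime_C_iff τ).mp (hs _ hf)⟩

end MvPolynomial

open MvPolynomial in
/-- An algebra `B` embedded in a polynomial ring is generated by any element `p` of positive degree
such that every element of `B` is congruent to a scalar modulo `p`. -/
theorem adjoin_singleton_eq_top_of_forall_dvd_sub {k B σ : Type*} [Field k] [CommRing B]
    [Algebra k B] (φ : B →ₐ[k] MvPolynomial σ k) (hφ : Function.Injective φ) {p : B}
    (hp : (φ p).totalDegree ≠ 0) (h : ∀ b, ∃ c : k, p ∣ b - algebraMap k B c) :
    Algebra.adjoin k {p} = ⊤ := by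
  have hφp : φ p ≠ 0 := by rintro h0; simp [h0] at hp
  rw [eq_top_iff]
  rintro b -
  induction hd : (φ b).totalDegree using Nat.strong_induction_on generalizing b with
  | _ d ih =>
    obtain ⟨c, q, hq⟩ := h b
    obtain rfl : b = p * q + algebraMap k B c := by rw [← hq, sub_add_cancel]
    refine add_mem (mul_mem (Algebra.self_mem_adjoin_singleton k p) ?_)
      (Subalgebra.algebraMap_mem _ c)
    by_cases hq0 : q = 0
    · simp [hq0]
    have hφq : φ q ≠ 0 := (map_ne_zero_iff φ hφ).mpr hq0
    refine ih _ ?_ rfl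
    have hmul : (φ p * φ q).totalDegree = (φ p).totalDegree + (φ q).totalDegree :=
      totalDegree_mul_of_isDomain hφp hφq
    rw [map_add, map_mul, AlgHom.commutes, algebraMap_eq,
      totalDegree_add_eq_left_of_totalDegree_lt (by rw [totalDegree_C]; omega), hmul] at hd
    omega

theorem nonempty_algEquiv_polynomial_of_mvPolynomial_algEquiv {k B σ τ : Type*} [Field k]
    [CommRing B] [Algebra k B] [Finite σ] [Finite τ] (hcard : Nat.card σ = Nat.card τ + 1)
    (e : MvPolynomial τ B ≃ₐ[k] MvPolynomial σ k) : Nonempty (B ≃ₐ[k] Polynomial k) := by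
  let φ : B →ₐ[k] MvPolynomial σ k := e.toAlgHom.comp (IsScalarTower.toAlgHom k B _)
  have hφ : Function.Injective φ := e.injective.comp (MvPolynomial.C_injective τ B)
  have : IsDomain B := hφ.isDomain φ.toRingHom
  have : UniqueFactorizationMonoid (MvPolynomial τ B) :=
    e.symm.toMulEquiv.uniqueFactorizationMonoid inferInstance
  have : IsNoetherianRing B := by
    refine isNoetherianRing_of_surjective (MvPolynomial σ k) B
      (MvPolynomial.constantCoeff.comp e.symm.toRingHom) fun b ↦ ⟨e (MvPolynomial.C b), ?_⟩
    simp
  have hdim : ringKrullDim B = 1 := by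
    have h := ringKrullDim_eq_of_ringEquiv e.toRingEquiv
    rw [MvPolynomial.ringKrullDim_of_isNoetherianRing,
      MvPolynomial.ringKrullDim_of_isNoetherianRing, ringKrullDim_eq_zero_of_field, hcard] at h
    refine (ENat.WithBot.add_natCast_cancel (c := Nat.card τ)).mp (h.trans ?_)
    push_cast
    ring
  have : Ring.KrullDimLE 1 B := Ring.krullDimLE_iff.mpr hdim.le
  let ε : B →ₐ[k] k := (MvPolynomial.aeval 0).comp φ
  have hε : RingHom.ker ε ≠ ⊥ := by
    intro h
    have hinj : Function.Injective ε := (RingHom.injective_iff_ker_eq_bot ε).mpr h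
    have hbij : Function.Bijective ε := ⟨hinj, fun c ↦ ⟨algebraMap k B c, ε.commutes c⟩⟩
    have h0 := ringKrullDim_eq_of_ringEquiv (RingEquiv.ofBijective ε hbij)
    rw [hdim, ringKrullDim_eq_zero_of_field] at h0
    exact one_ne_zero h0
  have : (RingHom.ker ε).IsPrime := RingHom.ker_isPrime ε
  obtain ⟨p, hpε, hp⟩ := MvPolynomial.exists_prime_mem_of_uniqueFactorizationMonoid τ hε
  have hspan : Ideal.span {p} = RingHom.ker ε :=
    (hp.isMaximal_span_singleton).eq_of_le Ideal.IsPrime.ne_top'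
      ((Ideal.span_singleton_le_iff_mem _).mpr hpε)
  have hdeg : (φ p).totalDegree ≠ 0 := by
    intro h
    obtain ⟨c, hc⟩ : ∃ c, φ p = MvPolynomial.C c :=
      ⟨_, MvPolynomial.totalDegree_eq_zero_iff_eq_C.mp h⟩
    have hpc : p = algebraMap k B c := hφ (hc.trans (φ.commutes c).symm)
    rw [hpc, RingHom.mem_ker, AlgHom.commutes] at hpε
    exact hp.ne_zero (by simpa [show c = 0 from hpε] using hpc)
  have hgen : Algebra.adjoin k {p} = ⊤ := by
    refine adjoin_singleton_eq_top_of_forall_dvd_sub φ hφ hdeg fun b ↦ ⟨ε b, ?_⟩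
    rw [← Ideal.mem_span_singleton, hspan, RingHom.mem_ker, map_sub, AlgHom.commutes]
    exact sub_self _
  have htr : Transcendental k p := fun halg ↦ hp.not_isUnit (halg.isIntegral.isUnit hp.ne_zero)
  refine ⟨(AlgEquiv.ofBijective (Polynomial.aeval p)
    ⟨transcendental_iff_injective.mp htr, ?_⟩).symm⟩
  rw [← AlgHom.range_eq_top, ← Algebra.adjoin_singleton_eq_range_aeval, hgen]

theorem nonempty_algEquiv_polynomial_of_tensorProduct_algEquiv {k B τ : Type*} [Field k]
    [CommRing B] [Algebra k B] [Finite τ]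
    (e : (Polynomial k ⊗[k] MvPolynomial τ k) ≃ₐ[k] (B ⊗[k] MvPolynomial τ k)) :
    Nonempty (B ≃ₐ[k] Polynomial k) := by
  have eB : B ⊗[k] MvPolynomial τ k ≃ₐ[k] MvPolynomial τ B :=
    (MvPolynomial.algebraTensorAlgEquiv k B).restrictScalars k
  have eX : Polynomial k ⊗[k] MvPolynomial τ k ≃ₐ[k] MvPolynomial τ (Polynomial k) :=
    (MvPolynomial.algebraTensorAlgEquiv k (Polynomial k)).restrictScalars k
  exact nonempty_algEquiv_polynomial_of_mvPolynomial_algEquiv (σ := Option τ)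
    Finite.card_option
    (eB.symm.trans (e.symm.trans (eX.trans (MvPolynomial.optionEquivRight k τ).symm)))

/-- Over an algebraically closed field `k`, the polynomial ring `k[t]` is strongly
cancellative: for every `n ≥ 1` and every `k`-algebra `B`, every `k`-algebra isomorphism
`k[t] ⊗[k] k[t₁,…,tₙ] ≅ B ⊗[k] k[t₁,…,tₙ]` implies `B ≅ k[t]`. -/
theorem statement8 (k : Type u) [Field k] [IsAlgClosed k] :
    ∀ (n : ℕ), 1 ≤ n → ∀ (B : Type u) [Ring B] [Algebra k B],
      Nonempty ((Polynomial k ⊗[k] MvPolynomial (Fin n) k) ≃ₐ[k]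
        (B ⊗[k] MvPolynomial (Fin n) k)) →
      Nonempty (B ≃ₐ[k] Polynomial k) := by
  rintro n - B _ _ ⟨e⟩
  have hinj : Function.Injective
      (Algebra.TensorProduct.includeLeft : B →ₐ[k] B ⊗[k] MvPolynomial (Fin n) k) :=
    Algebra.TensorProduct.includeLeft_injective (S := k) (algebraMap k (MvPolynomial (Fin n) k)).injective
  have hcomm (a b : B) : a * b = b * a :=
    (e.symm.injective.comp hinj) (by simp only [Function.comp_apply, map_mul, mul_comm])
  let _ : CommRing B := { ‹Ring B› with mul_comm := hcomm }
  exact nonempty_algEquiv_polynomial_of_tensorProduct_algEquiv e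
end
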